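/- arXiv:1605.04449 — 2 statements merged into one kernel-verified Lean document; each statement's English description precedes it below -/
import Mathlib

section
/- For any 0 < α < β < 1 and χ > 1/2, there exist constants c > 0 and λ₀ > 0 such that for all λ ≥ λ₀ and all N ≥ 1, P( D_{N,λ}(∂V_{αN}, ∂V_{βN}) ≥ N·exp((log N)^χ) ) ≤ c⁻¹( e^{−cλ²} + N^{−20} ). -/
open MeasureTheory ProbabilityTheory Set

attribute [local instance] Classical.propDecidable

noncomputable section

/-! ### The lattice boxes `V_N`, adjacency, boundary -/

/-- The `N × N` box `V_N ⊆ ℤ²`, centered at the origin or at `(1/2,1/2)` according to the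
parity of `N`. -/
def box (N : ℕ) : Finset (ℤ × ℤ) :=
  Finset.Icc (-(((N : ℤ) - 1) / 2)) ((N : ℤ) / 2) ×ˢ
    Finset.Icc (-(((N : ℤ) - 1) / 2)) ((N : ℤ) / 2)

/-- `V_x = V_{⌊x⌋}` for real `x`. -/
def boxR (x : ℝ) : Finset (ℤ × ℤ) := box ⌊x⌋₊

/-- Nearest-neighbour adjacency on `ℤ²`. -/
def adj (u v : ℤ × ℤ) : Prop := |u.1 - v.1| + |u.2 - v.2| = 1

/-- The four lattice neighbours of a point. -/
def nbrs (u : ℤ × ℤ) : Finset (ℤ × ℤ) :=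
  {(u.1 + 1, u.2), (u.1 - 1, u.2), (u.1, u.2 + 1), (u.1, u.2 - 1)}

/-- The (inner) boundary `∂V_N`. -/
def bdry (N : ℕ) : Finset (ℤ × ℤ) :=
  (box N).filter fun v => ∃ u ∈ nbrs v, u ∉ box N

/-- `∂V_x = ∂V_{⌊x⌋}` for real `x`. -/
def bdryR (x : ℝ) : Finset (ℤ × ℤ) := bdry ⌊x⌋₊

/-! ### Simple random walk: killed transition kernel, Green's function, harmonic measure -/

/-- `killedStep K n u v` is the probability that simple random walk started at `u` is at `v`
at time `n` without having visited the killing set `K` at any time `≤ n`. -/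
def killedStep (K : Set (ℤ × ℤ)) : ℕ → (ℤ × ℤ) → (ℤ × ℤ) → ℝ
  | 0, u, v => if u = v ∧ u ∉ K then 1 else 0
  | n + 1, u, v => if u ∈ K then 0 else (1 / 4) * ∑ w ∈ nbrs u, killedStep K n w v

/-- Green's function of simple random walk killed on the set `K`: the expected number of
visits to `v` strictly before hitting `K`, for the walk started at `u`. -/
def greenK (K : Set (ℤ × ℤ)) (u v : ℤ × ℤ) : ℝ := ∑' n, killedStep K n u v

/-- `G_{V_N}(u,v)`: Green's function of simple random walk killed at `∂V_N`. -/
def green (N : ℕ) (u v : ℤ × ℤ) : ℝ := greenK (↑(bdry N)) u v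

/-- `hitStep A n v u` is the probability that simple random walk started at `v` first hits
the set `A` at time `n`, and does so at the point `u`. -/
def hitStep (A : Set (ℤ × ℤ)) : ℕ → (ℤ × ℤ) → (ℤ × ℤ) → ℝ
  | 0, v, u => if v = u ∧ v ∈ A then 1 else 0
  | n + 1, v, u => if v ∈ A then 0 else (1 / 4) * ∑ w ∈ nbrs v, hitStep A n w u

/-- Harmonic measure `Hm(v, u; A) = ℙ_v(S_{τ_A} = u)`. -/
def hm (v u : ℤ × ℤ) (A : Set (ℤ × ℤ)) : ℝ := ∑' n, hitStep A n v u

/-- `Hm(v, B; A) = ∑_{u ∈ B} Hm(v, u; A)`. -/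
def hmSet (v : ℤ × ℤ) (B A : Set (ℤ × ℤ)) : ℝ := ∑' u : B, hm v (↑u) A

/-! ### Centered Gaussian families and the discrete GFF -/

/-- `f` is a centered Gaussian family (over the indices in `S`) with covariance `K`:
every finite linear combination of the `f i`, `i ∈ S`, is a centered Gaussian variable whose
variance is the corresponding quadratic form of `K`. -/
def IsGaussFam {Ω ι : Type*} [MeasurableSpace Ω] (P : Measure Ω)
    (f : ι → Ω → ℝ) (K : ι → ι → ℝ) (S : Set ι) : Prop :=
  (∀ i, Measurable (f i)) ∧
  ∀ l : ι →₀ ℝ, ↑l.support ⊆ S →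
    P.map (fun ω => ∑ i ∈ l.support, l i * f i ω) =
      gaussianReal 0 (∑ i ∈ l.support, ∑ j ∈ l.support, l i * l j * K i j).toNNReal

/-- Covariance of the discrete GFF on `V_N` with Dirichlet boundary conditions:
`(1/4) G_{V_N}(u,v)`. -/
def gffCov (N : ℕ) (u v : ℤ × ℤ) : ℝ :=
  if u ∈ box N ∧ v ∈ box N then (1 / 4) * green N u v else 0

/-- `η` is a discrete Gaussian free field on `V_N` with Dirichlet boundary conditions. -/
def IsGFF {Ω : Type*} [MeasurableSpace Ω] (N : ℕ) (P : Measure Ω)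
    (η : ℤ × ℤ → Ω → ℝ) : Prop :=
  IsGaussFam P η (gffCov N) Set.univ

/-! ### Paths and chemical distances in lattice subgraphs -/

/-- `p` is a nearest-neighbour path of `n` steps from `u` to `v` staying in `H`. -/
def IsPath (H : Set (ℤ × ℤ)) (u v : ℤ × ℤ) (n : ℕ) (p : ℕ → ℤ × ℤ) : Prop :=
  p 0 = u ∧ p n = v ∧ (∀ i ≤ n, p i ∈ H) ∧ ∀ i < n, adj (p i) (p (i + 1))

/-- The chemical distance (graph distance) between `A` and `B` inside `H` is `≤ t`. -/
def ConnLe (H : Set (ℤ × ℤ)) (A B : Set (ℤ × ℤ)) (t : ℝ) : Prop :=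
  ∃ n : ℕ, (n : ℝ) ≤ t ∧ ∃ u ∈ A, ∃ v ∈ B, ∃ p, IsPath H u v n p

/-- The chemical distance (graph distance) between `A` and `B` inside `H` is `≥ t`
(in particular this holds when `A` and `B` are not connected inside `H`). -/
def DistGe (H : Set (ℤ × ℤ)) (A B : Set (ℤ × ℤ)) (t : ℝ) : Prop :=
  ∀ n : ℕ, ∀ u ∈ A, ∀ v ∈ B, ∀ p, IsPath H u v n p → t ≤ (n : ℝ)

/-! ### Lattice calculus -/

def FS (f : ℤ × ℤ → ℝ) : Prop := ∃ s : Finset (ℤ × ℤ), ∀ u, u ∉ s → f u = 0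

def lap (f : ℤ × ℤ → ℝ) (u : ℤ × ℤ) : ℝ :=
  f (u + (1, 0)) + f (u - (1, 0)) + f (u + (0, 1)) + f (u - (0, 1)) - 4 * f u

def enT (f g : ℤ × ℤ → ℝ) (u : ℤ × ℤ) : ℝ :=
  (f (u + (1, 0)) - f u) * (g (u + (1, 0)) - g u) +
    (f (u + (0, 1)) - f u) * (g (u + (0, 1)) - g u)

def en (f g : ℤ × ℤ → ℝ) : ℝ := ∑' u, enT f g u

theorem FS.summable {f : ℤ × ℤ → ℝ} (h : FS f) : Summable f := by
  obtain ⟨s, hs⟩ := h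
  exact summable_of_ne_finset_zero (s := s) (fun u hu => hs u hu)

theorem FS.mul_right {f : ℤ × ℤ → ℝ} (h : FS f) (g : ℤ × ℤ → ℝ) : FS (fun u => f u * g u) := by
  obtain ⟨s, hs⟩ := h
  exact ⟨s, fun u hu => by simp [hs u hu]⟩

theorem FS.shift {f : ℤ × ℤ → ℝ} (h : FS f) (e : ℤ × ℤ) : FS (fun u => f (u + e)) := by
  obtain ⟨s, hs⟩ := h
  refine ⟨s.image (fun u => u - e), fun u hu => hs _ fun h => hu ?_⟩
  exact Finset.mem_image.2 ⟨u + e, h, by simp⟩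

theorem FS.add {f g : ℤ × ℤ → ℝ} (h : FS f) (h' : FS g) : FS (fun u => f u + g u) := by
  obtain ⟨s, hs⟩ := h
  obtain ⟨s', hs'⟩ := h'
  refine ⟨s ∪ s', fun u hu => ?_⟩
  simp only [Finset.mem_union, not_or] at hu
  simp [hs u hu.1, hs' u hu.2]

theorem FS.sub {f g : ℤ × ℤ → ℝ} (h : FS f) (h' : FS g) : FS (fun u => f u - g u) := by
  obtain ⟨s, hs⟩ := h
  obtain ⟨s', hs'⟩ := h'
  refine ⟨s ∪ s', fun u hu => ?_⟩
  simp only [Finset.mem_union, not_or] at hu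
  simp [hs u hu.1, hs' u hu.2]

theorem FS.enT {f g : ℤ × ℤ → ℝ} (h : FS f) : FS (enT f g) := by
  have h1 := ((h.shift (1, 0)).sub h).mul_right (fun u => g (u + (1, 0)) - g u)
  have h2 := ((h.shift (0, 1)).sub h).mul_right (fun u => g (u + (0, 1)) - g u)
  exact h1.add h2

theorem en_comm (f g : ℤ × ℤ → ℝ) : en f g = en g f := by
  unfold en enT
  refine tsum_congr fun u => by ring

theorem en_dir {f : ℤ × ℤ → ℝ} (h : FS f) (g : ℤ × ℤ → ℝ) (e : ℤ × ℤ) :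
    ∑' u, (f (u + e) - f u) * (g (u + e) - g u) =
      ∑' u, f u * (2 * g u - g (u + e) - g (u - e)) := by
  have h1 : Summable (fun u => f (u + e) * (g (u + e) - g u)) :=
    ((h.shift e).mul_right _).summable
  have h2 : Summable (fun u => f u * (g (u + e) - g u)) := (h.mul_right _).summable
  have h3 : Summable (fun u => f u * (g u - g (u - e))) := (h.mul_right _).summable
  have e1 : ∑' u, f (u + e) * (g (u + e) - g u) = ∑' u, f u * (g u - g (u - e)) := by
    rw [← (Equiv.addRight e).tsum_eq (fun u => f u * (g u - g (u - e)))]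
    simp
  calc ∑' u, (f (u + e) - f u) * (g (u + e) - g u)
      = ∑' u, (f (u + e) * (g (u + e) - g u) - f u * (g (u + e) - g u)) :=
        tsum_congr fun u => by ring
    _ = ∑' u, f u * (g u - g (u - e)) - ∑' u, f u * (g (u + e) - g u) := by
        rw [h1.tsum_sub h2, e1]
    _ = _ := by
        rw [← h3.tsum_sub h2]
        exact tsum_congr fun u => by ring

theorem sbp {f : ℤ × ℤ → ℝ} (h : FS f) (g : ℤ × ℤ → ℝ) :
    en f g = ∑' u, f u * (- lap g u) := by
  unfold en enT
  rw [Summable.tsum_add, en_dir h g, en_dir h g, ← Summable.tsum_add]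
  · exact tsum_congr fun u => by unfold lap; ring
  · exact (h.mul_right _).summable
  · exact (h.mul_right _).summable
  · exact (((h.shift (1, 0)).sub h).mul_right _).summable
  · exact (((h.shift (0, 1)).sub h).mul_right _).summable

theorem enT_self_nonneg (f : ℤ × ℤ → ℝ) (u : ℤ × ℤ) : 0 ≤ enT f f u := by
  unfold enT
  nlinarith [mul_self_nonneg (f (u + (1, 0)) - f u), mul_self_nonneg (f (u + (0, 1)) - f u)]

theorem en_self_nonneg (f : ℤ × ℤ → ℝ) : 0 ≤ en f f := tsum_nonneg (enT_self_nonneg f)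

theorem sum_enT_le {f : ℤ × ℤ → ℝ} (h : FS f) (s : Finset (ℤ × ℤ)) :
    ∑ u ∈ s, enT f f u ≤ en f f :=
  h.enT.summable.sum_le_tsum s (fun u _ => enT_self_nonneg f u)

theorem en_sub_self {f g : ℤ × ℤ → ℝ} (hf : FS f) (hg : FS g) :
    en (fun u => g u - f u) (fun u => g u - f u) = en g g - 2 * en f g + en f f := by
  unfold en
  rw [show ∑' u, enT (fun u => g u - f u) (fun u => g u - f u) u =
      ∑' u, ((enT g g u - 2 * enT f g u) + enT f f u) from
      tsum_congr fun u => by unfold enT; ring]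
  rw [Summable.tsum_add, Summable.tsum_sub, tsum_mul_left]
  · exact hg.enT.summable
  · exact hf.enT.summable.mul_left 2
  · exact hg.enT.summable.sub (hf.enT.summable.mul_left 2)
  · exact hf.enT.summable

theorem en_add_self {f g : ℤ × ℤ → ℝ} (hf : FS f) (hg : FS g) (t : ℝ) :
    en (fun u => g u + t * f u) (fun u => g u + t * f u)
      = en g g + 2 * t * en f g + t ^ 2 * en f f := by
  unfold en
  rw [show ∑' u, enT (fun u => g u + t * f u) (fun u => g u + t * f u) u =
      ∑' u, ((enT g g u + 2 * t * enT f g u) + t ^ 2 * enT f f u) from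
      tsum_congr fun u => by unfold enT; ring]
  rw [Summable.tsum_add, Summable.tsum_add, tsum_mul_left, tsum_mul_left]
  · exact hg.enT.summable
  · exact hf.enT.summable.mul_left (2 * t)
  · exact hg.enT.summable.add (hf.enT.summable.mul_left (2 * t))
  · exact hf.enT.summable.mul_left _

/-! ### Sobolev-type inequalities -/

theorem seg_ineq {f : ℤ × ℤ → ℝ} (h : FS f) (L m : ℕ) (hm : 0 < m)
    (h0 : ∀ j : ℕ, j < m → f ((L : ℤ), (j : ℤ)) = 0) :
    ((m : ℝ)⁻¹ * ∑ j ∈ Finset.range m, f (0, (j : ℤ))) ^ 2 ≤ (L / m : ℝ) * en f f := by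
  have hm' : (0 : ℝ) < m := by exact_mod_cast hm
  set d : ℕ × ℕ → ℝ := fun q => f ((q.1 : ℤ) + 1, (q.2 : ℤ)) - f ((q.1 : ℤ), (q.2 : ℤ)) with hd
  have key : ∑ j ∈ Finset.range m, f (0, (j : ℤ)) =
      - ∑ q ∈ Finset.range L ×ˢ Finset.range m, d q := by
    rw [Finset.sum_product_right, ← Finset.sum_neg_distrib]
    refine Finset.sum_congr rfl fun j hj => ?_
    have := Finset.sum_range_sub (fun i : ℕ => f ((i : ℤ), (j : ℤ))) L
    simp only [hd]
    push_cast at this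
    rw [this, h0 j (Finset.mem_range.1 hj)]
    ring
  have cs := sq_sum_le_card_mul_sum_sq (s := Finset.range L ×ˢ Finset.range m) (f := d)
  have le : ∑ q ∈ Finset.range L ×ˢ Finset.range m, d q ^ 2 ≤ en f f := by
    have inj : Set.InjOn (fun q : ℕ × ℕ => ((q.1 : ℤ), (q.2 : ℤ)))
        (↑(Finset.range L ×ˢ Finset.range m)) := by
      rintro ⟨a, b⟩ _ ⟨c, e⟩ _ hh
      simpa using hh
    refine le_trans ?_ (sum_enT_le h ((Finset.range L ×ˢ Finset.range m).image
      (fun q : ℕ × ℕ => ((q.1 : ℤ), (q.2 : ℤ)))))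
    rw [Finset.sum_image inj]
    refine Finset.sum_le_sum fun q _ => ?_
    simp only [hd, enT, Prod.mk_add_mk, add_zero]
    nlinarith [mul_self_nonneg (f ((q.1 : ℤ), (q.2 : ℤ) + 1) - f ((q.1 : ℤ), (q.2 : ℤ)))]
  simp only [Finset.card_product, Finset.card_range] at cs
  rw [key]
  push_cast at cs
  calc ((m : ℝ)⁻¹ * -∑ q ∈ Finset.range L ×ˢ Finset.range m, d q) ^ 2
      = (m : ℝ)⁻¹ ^ 2 * (∑ q ∈ Finset.range L ×ˢ Finset.range m, d q) ^ 2 := by ring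
    _ ≤ (m : ℝ)⁻¹ ^ 2 * (L * m * en f f) := by
        gcongr
        exact cs.trans (by gcongr)
    _ = _ := by field_simp

theorem log_step (F : ℕ → ℝ) (k : ℕ) :
    (((k : ℝ) + 1)⁻¹ * ∑ j ∈ Finset.range (k + 1), F j
      - ((k : ℝ) + 2)⁻¹ * ∑ j ∈ Finset.range (k + 2), F j) ^ 2
      ≤ ((k : ℝ) + 1)⁻¹ * ∑ j ∈ Finset.range (k + 1), (F (j + 1) - F j) ^ 2 := by
  -- difference is `1/(k+2)` times an average of `F j - F (k+1)`
  set V : ℝ := ∑ i ∈ Finset.range (k + 1), |F (i + 1) - F i| with hV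
  have hk : (0 : ℝ) < (k : ℝ) + 1 := by positivity
  have hk2 : (0 : ℝ) < (k : ℝ) + 2 := by positivity
  have hb : ∀ j ∈ Finset.range (k + 1), |F j - F (k + 1)| ≤ V := by
    intro j hj
    have hj' : j ≤ k + 1 := (Finset.mem_range.1 hj).le
    have e := Finset.sum_Ico_sub F hj'
    rw [abs_sub_comm, ← e]
    refine (Finset.abs_sum_le_sum_abs _ _).trans ?_
    rw [hV, Finset.range_eq_Ico]
    exact Finset.sum_le_sum_of_subset_of_nonneg (Finset.Ico_subset_Ico_left (Nat.zero_le _))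
      (fun _ _ _ => abs_nonneg _)
  have e1 : ((k : ℝ) + 1)⁻¹ * ∑ j ∈ Finset.range (k + 1), F j
      - ((k : ℝ) + 2)⁻¹ * ∑ j ∈ Finset.range (k + 2), F j
      = (((k : ℝ) + 1) * ((k : ℝ) + 2))⁻¹ * ∑ j ∈ Finset.range (k + 1), (F j - F (k + 1)) := by
    rw [Finset.sum_range_succ _ (k + 1), Finset.sum_sub_distrib]
    simp only [Finset.sum_const, Finset.card_range, nsmul_eq_mul]
    push_cast
    field_simp
    ring
  have e2 : |∑ j ∈ Finset.range (k + 1), (F j - F (k + 1))| ≤ ((k : ℝ) + 1) * V := by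
    refine (Finset.abs_sum_le_sum_abs _ _).trans ((Finset.sum_le_sum hb).trans ?_)
    simp
  have e3 : V ^ 2 ≤ ((k : ℝ) + 1) * ∑ j ∈ Finset.range (k + 1), (F (j + 1) - F j) ^ 2 := by
    have := sq_sum_le_card_mul_sum_sq (s := Finset.range (k + 1)) (f := fun i => |F (i + 1) - F i|)
    simpa using this
  have hS : 0 ≤ ∑ j ∈ Finset.range (k + 1), (F (j + 1) - F j) ^ 2 :=
    Finset.sum_nonneg fun _ _ => sq_nonneg _
  rw [e1, mul_pow, ← sq_abs (∑ j ∈ Finset.range (k + 1), (F j - F (k + 1)))]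
  calc _ ≤ ((((k : ℝ) + 1) * ((k : ℝ) + 2))⁻¹) ^ 2 * (((k : ℝ) + 1) * V) ^ 2 := by gcongr
    _ = (((k : ℝ) + 2)⁻¹) ^ 2 * V ^ 2 := by field_simp
    _ ≤ (((k : ℝ) + 1)⁻¹) ^ 2 *
        (((k : ℝ) + 1) * ∑ j ∈ Finset.range (k + 1), (F (j + 1) - F j) ^ 2) := by
        gcongr
        linarith
    _ = _ := by field_simp

theorem log_ineq {f : ℤ × ℤ → ℝ} (h : FS f) (v : ℤ × ℤ) (L : ℕ)
    (h0 : ∀ j : ℤ, f (v.1 + L, j) = 0) :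
    f v ^ 2 ≤ 2 * (1 + Real.log L) * en f f := by
  set F : ℕ → ℕ → ℝ := fun k j => f (v + ((k : ℤ), (j : ℤ))) with hF
  set a : ℕ → ℝ := fun k => ((k : ℝ) + 1)⁻¹ * ∑ j ∈ Finset.range (k + 1), F k j with ha
  set Ek : ℕ → ℝ := fun k => ∑ j ∈ Finset.range (k + 1),
    ((F (k + 1) j - F k j) ^ 2 + (F (k + 1) (j + 1) - F (k + 1) j) ^ 2) with hEk
  have step : ∀ k, (a k - a (k + 1)) ^ 2 ≤ 2 * ((k : ℝ) + 1)⁻¹ * Ek k := by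
    intro k
    have hk : (0 : ℝ) < (k : ℝ) + 1 := by positivity
    have l1 := log_step (F (k + 1)) k
    have l2 : (((k : ℝ) + 1)⁻¹ * ∑ j ∈ Finset.range (k + 1), (F (k + 1) j - F k j)) ^ 2 ≤
        ((k : ℝ) + 1)⁻¹ * ∑ j ∈ Finset.range (k + 1), (F (k + 1) j - F k j) ^ 2 := by
      have := sq_sum_le_card_mul_sum_sq (s := Finset.range (k + 1))
        (f := fun j => F (k + 1) j - F k j)
      simp only [Finset.card_range] at this
      push_cast at this
      rw [mul_pow]
      calc _ ≤ (((k : ℝ) + 1)⁻¹) ^ 2 * (((k : ℝ) + 1) *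
              ∑ j ∈ Finset.range (k + 1), (F (k + 1) j - F k j) ^ 2) := by gcongr
        _ = _ := by field_simp
    have e : a k - a (k + 1) = (((k : ℝ) + 1)⁻¹ * ∑ j ∈ Finset.range (k + 1), F (k + 1) j
      - ((k : ℝ) + 2)⁻¹ * ∑ j ∈ Finset.range (k + 2), F (k + 1) j)
      - (((k : ℝ) + 1)⁻¹ * ∑ j ∈ Finset.range (k + 1), (F (k + 1) j - F k j)) := by
      simp only [ha, Finset.sum_sub_distrib]
      push_cast
      ring
    have e' : Ek k = ∑ j ∈ Finset.range (k + 1), (F (k + 1) j - F k j) ^ 2 +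
        ∑ j ∈ Finset.range (k + 1), (F (k + 1) (j + 1) - F (k + 1) j) ^ 2 := by
      simp only [hEk, Finset.sum_add_distrib]
    rw [e, e']
    generalize (((k : ℝ) + 1)⁻¹ * ∑ j ∈ Finset.range (k + 1), F (k + 1) j
      - ((k : ℝ) + 2)⁻¹ * ∑ j ∈ Finset.range (k + 2), F (k + 1) j) = x at *
    generalize (((k : ℝ) + 1)⁻¹ * ∑ j ∈ Finset.range (k + 1), (F (k + 1) j - F k j)) = y at *
    nlinarith [sq_nonneg (x + y)]
  have a0 : a 0 = f v := by
    simp [ha, hF]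
    exact congrArg f (add_zero v)
  have aL : a L = 0 := by
    simp only [ha, hF]
    rw [Finset.sum_eq_zero, mul_zero]
    intro j _
    exact h0 _
  have tel : f v = ∑ k ∈ Finset.range L, (a k - a (k + 1)) := by
    rw [Finset.sum_range_sub', a0, aL, sub_zero]
  have hEnn : ∀ k, 0 ≤ Ek k := fun k => Finset.sum_nonneg fun _ _ => by positivity
  have cs := Finset.sum_sq_le_sum_mul_sum_of_sq_le_mul (Finset.range L)
    (r := fun k => a k - a (k + 1)) (f := fun k => 2 * ((k : ℝ) + 1)⁻¹) (g := Ek)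
    (fun k _ => by positivity) (fun k _ => hEnn k) (fun k _ => step k)
  have har : ∑ k ∈ Finset.range L, 2 * ((k : ℝ) + 1)⁻¹ ≤ 2 * (1 + Real.log L) := by
    rw [← Finset.mul_sum]
    have := harmonic_le_one_add_log L
    rw [harmonic] at this
    push_cast at this
    linarith
  have tot : ∑ k ∈ Finset.range L, Ek k ≤ en f f := by
    set T := (Finset.range L).sigma (fun k => Finset.range (k + 1)) with hT
    have t1 : ∑ k ∈ Finset.range L, Ek k = ∑ q ∈ T, (F (q.1 + 1) q.2 - F q.1 q.2) ^ 2 +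
        ∑ q ∈ T, (F (q.1 + 1) (q.2 + 1) - F (q.1 + 1) q.2) ^ 2 := by
      rw [← Finset.sum_add_distrib, hT, Finset.sum_sigma]
    have s1 : Summable (fun u => (f (u + (1, 0)) - f u) * (f (u + (1, 0)) - f u)) :=
      (((h.shift (1, 0)).sub h).mul_right _).summable
    have s2 : Summable (fun u => (f (u + (0, 1)) - f u) * (f (u + (0, 1)) - f u)) :=
      (((h.shift (0, 1)).sub h).mul_right _).summable
    have t2 : en f f = ∑' u, (f (u + (1, 0)) - f u) * (f (u + (1, 0)) - f u) +
        ∑' u, (f (u + (0, 1)) - f u) * (f (u + (0, 1)) - f u) := by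
      rw [← s1.tsum_add s2]; rfl
    rw [t1, t2]
    refine add_le_add ?_ ?_
    · refine le_trans ?_ (s1.sum_le_tsum
        (T.image (fun q => v + ((q.1 : ℤ), (q.2 : ℤ)))) (fun u _ => mul_self_nonneg _))
      rw [Finset.sum_image]
      · refine le_of_eq (Finset.sum_congr rfl fun q _ => ?_)
        simp only [hF]
        rw [pow_two, add_assoc, Prod.mk_add_mk]
        push_cast
        simp
        rfl
      · rintro ⟨a, b⟩ _ ⟨c, e⟩ _ hh
        simpa using hh
    · refine le_trans ?_ (s2.sum_le_tsum
        (T.image (fun q => v + ((q.1 : ℤ) + 1, (q.2 : ℤ)))) (fun u _ => mul_self_nonneg _))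
      rw [Finset.sum_image]
      · refine le_of_eq (Finset.sum_congr rfl fun q _ => ?_)
        simp only [hF]
        rw [pow_two, add_assoc, Prod.mk_add_mk]
        push_cast
        simp
        rfl
      · rintro ⟨a, b⟩ _ ⟨c, e⟩ _ hh
        simpa using hh
  rw [tel]
  refine cs.trans ?_
  exact mul_le_mul har tot (Finset.sum_nonneg fun k _ => hEnn k)
    (le_trans (Finset.sum_nonneg fun k _ => by positivity) har)

/-! ### Green's functions -/

theorem sum_nbrs (f : ℤ × ℤ → ℝ) (u : ℤ × ℤ) :
    ∑ w ∈ nbrs u, f w = f (u + (1, 0)) + f (u - (1, 0)) + f (u + (0, 1)) + f (u - (0, 1)) := by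
  obtain ⟨x, y⟩ := u
  unfold nbrs
  rw [Finset.sum_insert, Finset.sum_insert, Finset.sum_insert, Finset.sum_singleton]
  · simp only [Prod.mk_add_mk, Prod.mk_sub_mk, add_zero, sub_zero]
    ring
  · simp
    omega
  · simp
  · simp
    omega

theorem neg_lap_eq (f : ℤ × ℤ → ℝ) (u : ℤ × ℤ) : - lap f u = 4 * f u - ∑ w ∈ nbrs u, f w := by
  rw [sum_nbrs]; unfold lap; ring

theorem mem_nbrs_iff (u w : ℤ × ℤ) : w ∈ nbrs u ↔ adj u w := by
  obtain ⟨x, y⟩ := u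
  obtain ⟨z, t⟩ := w
  simp only [nbrs, adj, Finset.mem_insert, Finset.mem_singleton, Prod.mk.injEq]
  constructor
  · rintro (h | h | h | h) <;> obtain ⟨rfl, rfl⟩ := h <;> simp
  · intro h
    rcases abs_cases (x - z) with h1 | h1 <;> rcases abs_cases (y - t) with h2 | h2 <;> omega

theorem nbrs_symm {u w : ℤ × ℤ} (h : w ∈ nbrs u) : u ∈ nbrs w := by
  rw [mem_nbrs_iff] at *
  unfold adj at *
  rw [abs_sub_comm w.1, abs_sub_comm w.2]
  exact h

theorem ks_nonneg (K : Set (ℤ × ℤ)) (n : ℕ) (u v : ℤ × ℤ) : 0 ≤ killedStep K n u v := by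
  induction n generalizing u with
  | zero => simp only [killedStep]; split_ifs <;> norm_num
  | succ n ih =>
    simp only [killedStep]
    split_ifs
    · exact le_rfl
    · exact mul_nonneg (by norm_num) (Finset.sum_nonneg fun w _ => ih w)

theorem ks_of_mem (K : Set (ℤ × ℤ)) (n : ℕ) (u v : ℤ × ℤ) (hu : u ∈ K) :
    killedStep K n u v = 0 := by
  cases n <;> simp [killedStep, hu]

theorem ks_of_mem' (K : Set (ℤ × ℤ)) (n : ℕ) (u v : ℤ × ℤ) (hv : v ∈ K) :
    killedStep K n u v = 0 := by
  induction n generalizing u with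
  | zero =>
    simp only [killedStep]
    rw [if_neg]
    rintro ⟨rfl, h⟩
    exact h hv
  | succ n ih => simp [killedStep, ih]

theorem green_of_mem (K : Set (ℤ × ℤ)) (u v : ℤ × ℤ) (hu : u ∈ K) : greenK K u v = 0 := by
  simp [greenK, ks_of_mem K _ u v hu]

theorem green_of_mem' (K : Set (ℤ × ℤ)) (u v : ℤ × ℤ) (hv : v ∈ K) : greenK K u v = 0 := by
  simp [greenK, ks_of_mem' K _ u v hv]

theorem greenK_nonneg (K : Set (ℤ × ℤ)) (u v : ℤ × ℤ) : 0 ≤ greenK K u v :=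
  tsum_nonneg fun n => ks_nonneg K n u v

theorem ks_summable (K : Set (ℤ × ℤ)) (D : Finset (ℤ × ℤ))
    (hD : ∀ u ∈ D, u ∉ K ∧ ∀ w ∈ nbrs u, w ∈ D ∨ w ∈ K) (v u : ℤ × ℤ) (hu : u ∈ D) :
    Summable (fun n => killedStep K n u v) := by
  set C : ℝ := ∑ u ∈ D, (|(u.1 : ℝ)| + 1) ^ 2 with hC
  have hCb : ∀ u ∈ D, (|(u.1 : ℝ)| + 1) ^ 2 ≤ C := fun u hu =>
    Finset.single_le_sum (f := fun u : ℤ × ℤ => (|(u.1 : ℝ)| + 1) ^ 2)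
      (fun _ _ => by positivity) hu
  have key : ∀ M : ℕ, ∀ u ∈ D, ∑ n ∈ Finset.range M, killedStep K n u v
      ≤ 2 * (C - (u.1 : ℝ) ^ 2) := by
    intro M
    induction M with
    | zero =>
      intro u hu
      have := hCb u hu
      have h2 := abs_nonneg (u.1 : ℝ)
      have h3 := sq_abs (u.1 : ℝ)
      simp only [Finset.range_zero, Finset.sum_empty]
      nlinarith
    | succ M ih =>
      intro u hu
      have hb := hCb u hu
      rw [Finset.sum_range_succ']
      simp only [killedStep, if_neg (hD u hu).1]
      rw [← Finset.mul_sum, Finset.sum_comm]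
      have h1 : ∑ w ∈ nbrs u, ∑ n ∈ Finset.range M, killedStep K n w v ≤
          ∑ w ∈ nbrs u, 2 * (C - (w.1 : ℝ) ^ 2) := by
        refine Finset.sum_le_sum fun w hw => ?_
        rcases (hD u hu).2 w hw with h | h
        · exact ih w h
        · rw [Finset.sum_eq_zero fun n _ => ks_of_mem K n w v h]
          have : |(w.1 : ℝ)| ≤ |(u.1 : ℝ)| + 1 := by
            have hh : |w.1| ≤ |u.1| + 1 := by
              rw [mem_nbrs_iff] at hw
              unfold adj at hw
              have := abs_nonneg (u.2 - w.2)
              have h4 : |u.1 - w.1| ≤ 1 := by omega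
              rw [abs_le] at h4
              rcases abs_cases w.1 with h | h <;> rcases abs_cases u.1 with h' | h' <;> omega
            exact_mod_cast hh
          have h5 : (w.1 : ℝ) ^ 2 ≤ (|(u.1 : ℝ)| + 1) ^ 2 := by
            rw [← sq_abs (w.1 : ℝ)]
            gcongr
          linarith
      have h2 : ∑ w ∈ nbrs u, 2 * (C - (w.1 : ℝ) ^ 2) = 4 * (2 * (C - (u.1 : ℝ) ^ 2)) - 4 := by
        rw [sum_nbrs]
        simp
        ring
      have h3 : (if u = v ∧ u ∉ K then (1 : ℝ) else 0) ≤ 1 := by split_ifs <;> norm_num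
      linarith
  exact summable_of_sum_range_le (fun n => ks_nonneg K n u v) (fun M => key M u hu)

theorem green_eq (K : Set (ℤ × ℤ)) (D : Finset (ℤ × ℤ))
    (hD : ∀ u ∈ D, u ∉ K ∧ ∀ w ∈ nbrs u, w ∈ D ∨ w ∈ K) (v u : ℤ × ℤ) (hu : u ∈ D) :
    greenK K u v = (if u = v then 1 else 0) + (1 / 4) * ∑ w ∈ nbrs u, greenK K w v := by
  have hs := ks_summable K D hD v u hu
  unfold greenK
  rw [hs.tsum_eq_zero_add, ← Summable.tsum_finsetSum, ← tsum_mul_left]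
  · congr 1
    · simp [killedStep, (hD u hu).1]
    · exact tsum_congr fun n => by simp [killedStep, (hD u hu).1]
  · intro w hw
    rcases (hD u hu).2 w hw with h | h
    · exact ks_summable K D hD v w h
    · simp only [ks_of_mem K _ w v h]
      exact summable_zero

theorem exists_g (ν : ℤ × ℤ → ℝ) (D : Finset (ℤ × ℤ)) :
    ∃ g : ℤ × ℤ → ℝ, ((∀ u, 0 ≤ ν u) → ∀ u, 0 ≤ g u) ∧ (∀ u, u ∉ D → g u = 0) ∧
      ∀ u ∈ D, - lap g u = ν u := by
  set K : Set (ℤ × ℤ) := (↑D : Set (ℤ × ℤ))ᶜ with hK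
  have hD : ∀ u ∈ D, u ∉ K ∧ ∀ w ∈ nbrs u, w ∈ D ∨ w ∈ K := by
    intro u hu
    refine ⟨by simp [hK, hu], fun w _ => ?_⟩
    simp only [hK, Set.mem_compl_iff, Finset.mem_coe]
    exact em _
  refine ⟨fun u => ∑ v ∈ D, (1 / 4) * greenK K u v * ν v, ?_, ?_, ?_⟩
  · intro hν u
    exact Finset.sum_nonneg fun v _ => mul_nonneg
      (mul_nonneg (by norm_num) (greenK_nonneg K u v)) (hν v)
  · intro u hu
    refine Finset.sum_eq_zero fun v _ => ?_
    rw [green_of_mem K u v (by simpa [hK] using hu)]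
    ring
  · intro u hu
    rw [neg_lap_eq, Finset.sum_comm, Finset.mul_sum, ← Finset.sum_sub_distrib]
    rw [Finset.sum_eq_single_of_mem u hu]
    · rw [green_eq K D hD u u hu, ← Finset.sum_mul, ← Finset.mul_sum]
      simp
      ring
    · intro v _ hv
      rw [green_eq K D hD v u hu, ← Finset.sum_mul, ← Finset.mul_sum, if_neg hv.symm]
      ring

def intr (N : ℕ) : Finset (ℤ × ℤ) := box N \ bdry N

theorem mem_intr {N : ℕ} {u : ℤ × ℤ} : u ∈ intr N ↔ u ∈ box N ∧ ∀ w ∈ nbrs u, w ∈ box N := by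
  simp only [intr, bdry, Finset.mem_sdiff, Finset.mem_filter]
  constructor
  · rintro ⟨h, h'⟩
    refine ⟨h, fun w hw => ?_⟩
    by_contra hc
    exact h' ⟨h, w, hw, hc⟩
  · rintro ⟨h, h'⟩
    refine ⟨h, ?_⟩
    rintro ⟨_, w, hw, hc⟩
    exact hc (h' w hw)

theorem cov_off (N : ℕ) (u a : ℤ × ℤ) (hu : u ∉ intr N) : gffCov N u a = 0 := by
  unfold gffCov
  split_ifs with h
  · rw [green, green_of_mem, mul_zero]
    by_contra hc
    exact hu (Finset.mem_sdiff.2 ⟨h.1, by simpa using hc⟩)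
  · rfl

theorem cov_off' (N : ℕ) (u a : ℤ × ℤ) (ha : a ∉ intr N) : gffCov N u a = 0 := by
  unfold gffCov
  split_ifs with h
  · rw [green, green_of_mem', mul_zero]
    by_contra hc
    exact ha (Finset.mem_sdiff.2 ⟨h.2, by simpa using hc⟩)
  · rfl

theorem cov_FS (N : ℕ) (a : ℤ × ℤ) : FS (fun u => gffCov N u a) :=
  ⟨intr N, fun u hu => cov_off N u a hu⟩

theorem cov_lap (N : ℕ) (u a : ℤ × ℤ) (hu : u ∈ intr N) :
    - lap (fun u => gffCov N u a) u = if u = a then 1 else 0 := by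
  have hD : ∀ u ∈ intr N, u ∉ (↑(bdry N) : Set (ℤ × ℤ)) ∧
      ∀ w ∈ nbrs u, w ∈ intr N ∨ w ∈ (↑(bdry N) : Set (ℤ × ℤ)) := by
    intro u hu
    refine ⟨by simpa using (Finset.mem_sdiff.1 hu).2, fun w hw => ?_⟩
    have := (mem_intr.1 hu).2 w hw
    by_cases h : w ∈ bdry N
    · right; simpa using h
    · left; exact Finset.mem_sdiff.2 ⟨this, h⟩
  have hu' := mem_intr.1 hu
  rw [neg_lap_eq]
  by_cases ha : a ∈ box N
  · rw [Finset.sum_congr rfl (fun w hw => show gffCov N w a = (1 / 4) * green N w a by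
      simp [gffCov, hu'.2 w hw, ha])]
    simp only [gffCov, hu'.1, ha, and_self, if_true]
    rw [← Finset.mul_sum]
    unfold green
    rw [green_eq _ _ hD a u hu]
    ring
  · rw [if_neg (by rintro rfl; exact ha hu'.1)]
    simp [gffCov, ha]

/-- pairing with a function vanishing off the interior -/
theorem en_cov (N : ℕ) (f : ℤ × ℤ → ℝ) (hf : ∀ u, u ∉ intr N → f u = 0) (a : ℤ × ℤ) :
    en f (fun u => gffCov N u a) = f a := by
  rw [sbp ⟨intr N, hf⟩]
  have : ∀ u, f u * - lap (fun u => gffCov N u a) u = if u = a then f a else 0 := by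
    intro u
    by_cases hu : u ∈ intr N
    · rw [cov_lap N u a hu]
      split_ifs with h
      · rw [h, mul_one]
      · rw [mul_zero]
    · rw [hf u hu, zero_mul]
      split_ifs with h
      · rw [← h, hf u hu]
      · rfl
  rw [tsum_congr this, tsum_ite_eq]

theorem cov_symm (N : ℕ) (u a : ℤ × ℤ) : gffCov N u a = gffCov N a u := by
  rw [← en_cov N (fun u => gffCov N u a) (fun u hu => cov_off N u a hu) u, en_comm,
    en_cov N (fun x => gffCov N x u) (fun x hx => cov_off N x u hx) a]

def pot (N : ℕ) (B : Finset (ℤ × ℤ)) (l : ℤ × ℤ → ℝ) (u : ℤ × ℤ) : ℝ :=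
  ∑ j ∈ B, l j * gffCov N u j

theorem pot_off (N : ℕ) (B : Finset (ℤ × ℤ)) (l : ℤ × ℤ → ℝ) (u : ℤ × ℤ) (hu : u ∉ intr N) :
    pot N B l u = 0 :=
  Finset.sum_eq_zero fun j _ => by rw [cov_off N u j hu, mul_zero]

theorem pot_lap (N : ℕ) (B : Finset (ℤ × ℤ)) (l : ℤ × ℤ → ℝ) (u : ℤ × ℤ) (hu : u ∈ intr N) :
    - lap (pot N B l) u = if u ∈ B then l u else 0 := by
  have : - lap (pot N B l) u = ∑ j ∈ B, l j * (- lap (fun u => gffCov N u j) u) := by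
    unfold lap pot
    simp only [mul_neg, mul_sub, mul_add, Finset.sum_add_distrib, Finset.sum_sub_distrib,
      Finset.sum_neg_distrib, Finset.mul_sum]
    congr 2
    exact Finset.sum_congr rfl fun j _ => by ring
  rw [this]
  simp only [cov_lap N u _ hu]
  simp

theorem quad_eq (N : ℕ) (B : Finset (ℤ × ℤ)) (l : ℤ × ℤ → ℝ) :
    ∑ i ∈ B, l i * pot N B l i = en (pot N B l) (pot N B l) := by
  rw [sbp ⟨intr N, pot_off N B l⟩]
  rw [tsum_eq_sum (s := B)]
  · refine Finset.sum_congr rfl fun i hi => ?_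
    by_cases h : i ∈ intr N
    · rw [pot_lap N B l i h, if_pos hi, mul_comm]
    · rw [pot_off N B l i h]; ring
  · intro u hu
    by_cases h : u ∈ intr N
    · rw [pot_lap N B l u h, if_neg hu, mul_zero]
    · rw [pot_off N B l u h]; ring

theorem quad_eq' (N : ℕ) (B : Finset (ℤ × ℤ)) (l : ℤ × ℤ → ℝ) :
    ∑ i ∈ B, ∑ j ∈ B, l i * l j * gffCov N i j = en (pot N B l) (pot N B l) := by
  rw [← quad_eq]
  refine Finset.sum_congr rfl fun i _ => ?_
  unfold pot
  rw [Finset.mul_sum]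
  exact Finset.sum_congr rfl fun j _ => by ring

theorem quad_nonneg (N : ℕ) (B : Finset (ℤ × ℤ)) (l : ℤ × ℤ → ℝ) :
    0 ≤ ∑ i ∈ B, ∑ j ∈ B, l i * l j * gffCov N i j := by
  rw [quad_eq']; exact en_self_nonneg _

theorem quad_le (N : ℕ) (B : Finset (ℤ × ℤ)) (l : ℤ × ℤ → ℝ) (C : ℝ) (hC : 0 ≤ C)
    (h : ∀ f : ℤ × ℤ → ℝ, (∀ u, u ∉ intr N → f u = 0) → (∑ i ∈ B, l i * f i) ^ 2 ≤ C * en f f) :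
    ∑ i ∈ B, ∑ j ∈ B, l i * l j * gffCov N i j ≤ C := by
  have h1 := h (pot N B l) (pot_off N B l)
  rw [quad_eq] at h1
  rw [quad_eq']
  have h2 := en_self_nonneg (pot N B l)
  by_contra hc
  push Not at hc
  nlinarith

theorem mem_box {N : ℕ} {u : ℤ × ℤ} : u ∈ box N ↔
    (-(((N : ℤ) - 1) / 2) ≤ u.1 ∧ u.1 ≤ (N : ℤ) / 2) ∧
      (-(((N : ℤ) - 1) / 2) ≤ u.2 ∧ u.2 ≤ (N : ℤ) / 2) := by
  simp only [box, Finset.mem_product, Finset.mem_Icc]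

theorem cov_diag_le (N : ℕ) (hN : 1 ≤ N) (v : ℤ × ℤ) :
    gffCov N v v ≤ 2 * (1 + Real.log N) := by
  have hlog : 0 ≤ Real.log N := Real.log_nonneg (by exact_mod_cast hN)
  by_cases hv : v ∈ intr N
  · have := quad_le N {v} (fun _ => 1) (2 * (1 + Real.log N)) (by positivity) (by
      intro f hf
      simp only [Finset.sum_singleton, one_mul]
      refine log_ineq ⟨intr N, hf⟩ v N fun j => hf _ fun hc => ?_
      have h1 := mem_box.1 (mem_intr.1 hc).1
      have h2 := mem_box.1 (mem_intr.1 hv).1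
      simp only at h1
      omega)
    simpa using this
  · rw [cov_off N v v hv]
    positivity

/-! ### Harmonic measure and energy -/

def gfun (ν : ℤ × ℤ → ℝ) (D : Finset (ℤ × ℤ)) : ℤ × ℤ → ℝ := Classical.choose (exists_g ν D)

theorem gfun_nonneg {ν : ℤ × ℤ → ℝ} (hν : ∀ u, 0 ≤ ν u) (D : Finset (ℤ × ℤ)) (u : ℤ × ℤ) :
    0 ≤ gfun ν D u := (Classical.choose_spec (exists_g ν D)).1 hν u

theorem gfun_off (ν : ℤ × ℤ → ℝ) (D : Finset (ℤ × ℤ)) (u : ℤ × ℤ) (hu : u ∉ D) :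
    gfun ν D u = 0 := (Classical.choose_spec (exists_g ν D)).2.1 u hu

theorem gfun_lap (ν : ℤ × ℤ → ℝ) (D : Finset (ℤ × ℤ)) (u : ℤ × ℤ) (hu : u ∈ D) :
    - lap (gfun ν D) u = ν u := (Classical.choose_spec (exists_g ν D)).2.2 u hu

theorem gfun_FS (ν : ℤ × ℤ → ℝ) (D : Finset (ℤ × ℤ)) : FS (gfun ν D) := ⟨D, gfun_off ν D⟩

def pm (ν : ℤ × ℤ → ℝ) (D : Finset (ℤ × ℤ)) (u : ℤ × ℤ) : ℝ := ν u + lap (gfun ν D) u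

def Rf (ν : ℤ × ℤ → ℝ) (D : Finset (ℤ × ℤ)) : ℝ := en (gfun ν D) (gfun ν D)

theorem pm_of_mem (ν : ℤ × ℤ → ℝ) (D : Finset (ℤ × ℤ)) (u : ℤ × ℤ) (hu : u ∈ D) :
    pm ν D u = 0 := by
  have := gfun_lap ν D u hu
  unfold pm
  linarith

theorem lap_off (ν : ℤ × ℤ → ℝ) (D : Finset (ℤ × ℤ)) (u : ℤ × ℤ) (hu : u ∉ D) :
    lap (gfun ν D) u = ∑ w ∈ nbrs u, gfun ν D w := by
  have := neg_lap_eq (gfun ν D) u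
  rw [gfun_off ν D u hu] at this
  linarith

theorem pm_nonneg {ν : ℤ × ℤ → ℝ} (hν : ∀ u, 0 ≤ ν u) (D : Finset (ℤ × ℤ)) (u : ℤ × ℤ) :
    0 ≤ pm ν D u := by
  by_cases hu : u ∈ D
  · rw [pm_of_mem ν D u hu]
  · unfold pm
    rw [lap_off ν D u hu]
    exact add_nonneg (hν u) (Finset.sum_nonneg fun w _ => gfun_nonneg hν D w)

theorem pm_eq_zero (ν : ℤ × ℤ → ℝ) (D : Finset (ℤ × ℤ)) (u : ℤ × ℤ) (h0 : ν u = 0)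
    (h : u ∉ D → ∀ w ∈ nbrs u, w ∉ D) : pm ν D u = 0 := by
  by_cases hu : u ∈ D
  · exact pm_of_mem ν D u hu
  · unfold pm
    rw [lap_off ν D u hu, h0, Finset.sum_eq_zero, add_zero]
    exact fun w hw => gfun_off ν D w (h hu w hw)

theorem lap_off_box (ν : ℤ × ℤ → ℝ) (D : Finset (ℤ × ℤ)) (b : ℕ) (hD : D ⊆ intr b) (u : ℤ × ℤ)
    (hu : u ∉ box b) : lap (gfun ν D) u = 0 := by
  have h1 : u ∉ D := fun h => hu (mem_intr.1 (hD h)).1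
  rw [lap_off ν D u h1]
  refine Finset.sum_eq_zero fun w hw => gfun_off ν D w fun h => hu ?_
  exact (mem_intr.1 (hD h)).2 u (nbrs_symm hw)

theorem tsum_lap {f : ℤ × ℤ → ℝ} (h : FS f) : ∑' u, lap f u = 0 := by
  have e : ∀ e : ℤ × ℤ, ∑' u, f (u + e) = ∑' u, f u := fun e => (Equiv.addRight e).tsum_eq f
  have e' : ∀ e : ℤ × ℤ, ∑' u, f (u - e) = ∑' u, f u := fun e => (Equiv.subRight e).tsum_eq f
  have s : ∀ e : ℤ × ℤ, Summable (fun u => f (u + e)) := fun e => (h.shift e).summable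
  have s' : ∀ e : ℤ × ℤ, Summable (fun u => f (u - e)) := fun e => by
    simpa [sub_eq_add_neg] using s (-e)
  unfold lap
  rw [Summable.tsum_sub, Summable.tsum_add, Summable.tsum_add, Summable.tsum_add, tsum_mul_left,
    e, e, e', e']
  · ring
  · exact s _
  · exact s' _
  · exact (s _).add (s' _)
  · exact s _
  · exact ((s _).add (s' _)).add (s _)
  · exact s' _
  · exact (((s _).add (s' _)).add (s _)).add (s' _)
  · exact h.summable.mul_left 4

theorem pm_sum (ν : ℤ × ℤ → ℝ) (D : Finset (ℤ × ℤ)) (b : ℕ) (hD : D ⊆ intr b)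
    (h1 : ∑ u ∈ box b, ν u = 1) : ∑ u ∈ box b, pm ν D u = 1 := by
  unfold pm
  have e : ∑' u, lap (gfun ν D) u = ∑ u ∈ box b, lap (gfun ν D) u :=
    tsum_eq_sum (fun u hu => lap_off_box ν D b hD u hu)
  rw [Finset.sum_add_distrib, h1, ← e, tsum_lap (gfun_FS ν D), add_zero]

theorem en_gfun (ν : ℤ × ℤ → ℝ) (D : Finset (ℤ × ℤ)) (f : ℤ × ℤ → ℝ)
    (hf : ∀ u, u ∉ D → f u = 0) : en f (gfun ν D) = ∑ u ∈ D, ν u * f u := by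
  rw [sbp ⟨D, hf⟩, tsum_eq_sum (s := D) (fun u hu => by rw [hf u hu, zero_mul])]
  exact Finset.sum_congr rfl fun u hu => by rw [gfun_lap ν D u hu, mul_comm]

def ind (S : Finset (ℤ × ℤ)) (u : ℤ × ℤ) : ℝ := if u ∈ S then 1 else 0

theorem ind_off (S : Finset (ℤ × ℤ)) (u : ℤ × ℤ) (hu : u ∉ S) : ind S u = 0 := by simp [ind, hu]

theorem en_ind (S : Finset (ℤ × ℤ)) (g : ℤ × ℤ → ℝ) : en (ind S) g = ∑ u ∈ S, - lap g u := by
  rw [sbp ⟨S, ind_off S⟩, tsum_eq_sum (s := S) (fun u hu => by rw [ind_off S u hu, zero_mul])]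
  exact Finset.sum_congr rfl fun u hu => by simp [ind, hu]

theorem en_ind_self (S : Finset (ℤ × ℤ)) : en (ind S) (ind S) ≤ 4 * S.card := by
  rw [en_ind, mul_comm, ← nsmul_eq_mul, ← Finset.sum_const]
  refine Finset.sum_le_sum fun u hu => ?_
  rw [neg_lap_eq]
  have : 0 ≤ ∑ w ∈ nbrs u, ind S w := Finset.sum_nonneg fun w _ => by
    unfold ind; split_ifs <;> norm_num
  have h2 : ind S u = 1 := by simp [ind, hu]
  linarith

theorem energy_step (ν : ℤ × ℤ → ℝ) (D D' S : Finset (ℤ × ℤ)) (hD : D' ⊆ D) (hS : S ⊆ D)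
    (t : ℝ) :
    Rf ν D' + 2 * t * ∑ v ∈ S, pm ν D' v - 4 * t ^ 2 * S.card ≤ Rf ν D := by
  set f : ℤ × ℤ → ℝ := fun u => gfun ν D' u + t * ind S u with hf
  have f0 : ∀ u, u ∉ D → f u = 0 := fun u hu => by
    simp [hf, gfun_off ν D' u (fun h => hu (hD h)), ind_off S u (fun h => hu (hS h))]
  have p1 := en_self_nonneg (fun u => gfun ν D u - f u)
  rw [en_sub_self ⟨D, f0⟩ (gfun_FS ν D), en_gfun ν D f f0] at p1
  have p2 : en f f = _ := en_add_self (f := ind S) ⟨S, ind_off S⟩ (gfun_FS ν D') t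
  have p3 : ∑ u ∈ D, ν u * f u = Rf ν D' + t * ∑ u ∈ S, ν u := by
    unfold Rf
    rw [en_gfun ν D' _ (gfun_off ν D')]
    simp only [hf, mul_add, Finset.sum_add_distrib]
    congr 1
    · symm
      refine Finset.sum_subset hD fun u _ hu => by rw [gfun_off ν D' u hu, mul_zero]
    · rw [Finset.mul_sum]
      rw [← Finset.sum_subset hS (fun u _ hu => by rw [ind_off S u hu]; ring)]
      exact Finset.sum_congr rfl fun u hu => by simp [ind, hu]; ring
  have p4 : ∑ v ∈ S, pm ν D' v = ∑ u ∈ S, ν u - ∑ u ∈ S, - lap (gfun ν D') u := by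
    unfold pm
    rw [Finset.sum_add_distrib, Finset.sum_neg_distrib]
    ring
  have p5 := en_ind_self S
  rw [en_ind S (gfun ν D')] at p2
  rw [p2, p3] at p1
  rw [p4]
  unfold Rf at *
  nlinarith [mul_le_mul_of_nonneg_left p5 (sq_nonneg t)]

theorem Rf_nonneg (ν : ℤ × ℤ → ℝ) (D : Finset (ℤ × ℤ)) : 0 ≤ Rf ν D := en_self_nonneg _

theorem Rf_le (ν : ℤ × ℤ → ℝ) (D : Finset (ℤ × ℤ)) (C : ℝ) (hC : 0 ≤ C)
    (h : ∀ f : ℤ × ℤ → ℝ, (∀ u, u ∉ D → f u = 0) → (∑ i ∈ D, ν i * f i) ^ 2 ≤ C * en f f) :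
    Rf ν D ≤ C := by
  have h1 := h _ (gfun_off ν D)
  rw [← en_gfun ν D _ (gfun_off ν D)] at h1
  have h2 := Rf_nonneg ν D
  unfold Rf at *
  by_contra hc
  push Not at hc
  nlinarith

/-! ### The exploration -/

def nb (S : Finset (ℤ × ℤ)) : Finset (ℤ × ℤ) := S.biUnion nbrs

def stp (ν : ℤ × ℤ → ℝ) (h : ℝ) (H : Finset (ℤ × ℤ))
    (q : Finset (ℤ × ℤ) × Finset (ℤ × ℤ)) : Finset (ℤ × ℤ) × Finset (ℤ × ℤ) :=
  if ∑ v ∈ q.2, pm ν q.1 v ≤ h then q else (q.1 \ nb q.2, (nb q.2 ∩ q.1) ∩ H)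

def st (ν : ℤ × ℤ → ℝ) (h : ℝ) (b : ℕ) (H : Finset (ℤ × ℤ)) :
    ℕ → Finset (ℤ × ℤ) × Finset (ℤ × ℤ)
  | 0 => (intr b, bdry b ∩ H)
  | n + 1 => stp ν h H (st ν h b H n)

section explore

variable {ν : ℤ × ℤ → ℝ} {h : ℝ} {b : ℕ} {H : Finset (ℤ × ℤ)}

theorem st_succ_sub (n : ℕ) : (st ν h b H (n + 1)).1 ⊆ (st ν h b H n).1 := by
  simp only [st, stp]
  split_ifs
  · exact Finset.Subset.refl _
  · exact Finset.sdiff_subset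

theorem st_sub (n : ℕ) : (st ν h b H n).1 ⊆ intr b := by
  induction n with
  | zero => exact Finset.Subset.refl _
  | succ n ih => exact (st_succ_sub n).trans ih

theorem st_SH (n : ℕ) : (st ν h b H n).2 ⊆ H := by
  induction n with
  | zero => exact Finset.inter_subset_right
  | succ n ih =>
    simp only [st, stp]
    split_ifs
    · exact ih
    · exact Finset.inter_subset_right

theorem st_disj (n : ℕ) (s : ℤ × ℤ) (hs : s ∈ (st ν h b H n).2) : s ∉ (st ν h b H n).1 := by
  induction n with
  | zero =>
    simp only [st, intr, Finset.mem_sdiff, Finset.mem_inter] at *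
    tauto
  | succ n ih =>
    simp only [st, stp] at *
    split_ifs at * with hc
    · exact ih hs
    · simp only [Finset.mem_sdiff, Finset.mem_inter] at *
      tauto

theorem st_bd (n : ℕ) (v w : ℤ × ℤ) (hv : v ∉ (st ν h b H n).1) (hw : w ∈ nbrs v)
    (hwD : w ∈ (st ν h b H n).1) : v ∈ (st ν h b H n).2 ∨ v ∉ H := by
  induction n with
  | zero =>
    simp only [st] at *
    have h1 := (mem_intr.1 hwD).2 v (nbrs_symm hw)
    simp only [intr, Finset.mem_sdiff, Finset.mem_inter] at *
    tauto
  | succ n ih =>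
    simp only [st, stp] at *
    split_ifs at * with hc
    · exact ih hv hwD
    · simp only [Finset.mem_sdiff, Finset.mem_inter] at *
      by_cases hvD : v ∈ (st ν h b H n).1
      · tauto
      · rcases ih hvD hwD.1 with h1 | h1
        · exact absurd (Finset.mem_biUnion.2 ⟨v, h1, hw⟩) hwD.2
        · exact Or.inr h1

theorem st_path (n : ℕ) (s : ℤ × ℤ) (hs : s ∈ (st ν h b H n).2) :
    ∃ k ≤ n, ∃ v ∈ bdry b, ∃ p, IsPath (↑H) s v k p := by
  induction n generalizing s with
  | zero =>
    simp only [st, Finset.mem_inter] at hs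
    refine ⟨0, le_rfl, s, hs.1, fun _ => s, rfl, rfl, fun i _ => by simpa using hs.2, ?_⟩
    intro i hi
    omega
  | succ n ih =>
    simp only [st, stp] at hs
    split_ifs at hs with hc
    · obtain ⟨k, hk, rest⟩ := ih s hs
      exact ⟨k, by omega, rest⟩
    · simp only [Finset.mem_inter] at hs
      obtain ⟨s', hs', hss⟩ := Finset.mem_biUnion.1 hs.1.1
      obtain ⟨k, hk, v, hv, p, p0, pk, pH, pa⟩ := ih s' hs'
      refine ⟨k + 1, by omega, v, hv, fun i => if i = 0 then s else p (i - 1), ?_, ?_, ?_, ?_⟩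
      · simp
      · simpa using pk
      · intro i hi
        by_cases h0 : i = 0
        · simpa [h0] using hs.2
        · simp only [h0, if_false]
          exact pH _ (by omega)
      · intro i hi
        by_cases h0 : i = 0
        · subst h0
          simp only [if_true, zero_add, one_ne_zero, if_false, Nat.sub_self, p0]
          exact (mem_nbrs_iff _ _).1 (nbrs_symm hss)
        · have := pa (i - 1) (by omega)
          simp only [h0, if_false, Nat.add_eq_zero_iff, one_ne_zero, and_false]
          rw [show i + 1 - 1 = i - 1 + 1 by omega]
          exact this

theorem box_mono {a b : ℕ} (hab : a ≤ b) : box a ⊆ box b := by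
  intro u hu
  rw [mem_box] at *
  have : (a : ℤ) ≤ b := by exact_mod_cast hab
  omega

theorem intr_mono {a b : ℕ} (hab : a ≤ b) : intr a ⊆ intr b := by
  intro u hu
  rw [mem_intr] at *
  exact ⟨box_mono hab hu.1, fun w hw => box_mono hab (hu.2 w hw)⟩

theorem st_int {a : ℕ} (hab : a ≤ b) (n : ℕ)
    (hno : ∀ k ≤ n, ∀ u ∈ bdry a, ∀ v ∈ bdry b, ∀ p, ¬ IsPath (↑H) u v k p) :
    intr a ⊆ (st ν h b H n).1 := by
  induction n with
  | zero => exact intr_mono hab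
  | succ n ih =>
    have ih' := ih (fun k hk => hno k (by omega))
    simp only [st, stp]
    split_ifs with hc
    · exact ih'
    · intro z hz
      refine Finset.mem_sdiff.2 ⟨ih' hz, fun hzn => ?_⟩
      obtain ⟨s, hs, hzs⟩ := Finset.mem_biUnion.1 hzn
      have h1 : s ∈ box a := (mem_intr.1 hz).2 s (nbrs_symm hzs)
      have h2 : s ∈ bdry a := by
        by_contra hc2
        exact st_disj n s hs (ih' (Finset.mem_sdiff.2 ⟨h1, hc2⟩))
      obtain ⟨k, hk, v, hv, p, hp⟩ := st_path n s hs
      exact hno k (by omega) s h2 v hv p hp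

theorem st_loc (H' : Finset (ℤ × ℤ)) (n : ℕ)
    (hh : ∀ v, v ∉ (st ν h b H n).1 → (v ∈ H ↔ v ∈ H')) :
    st ν h b H' n = st ν h b H n := by
  induction n with
  | zero =>
    simp only [st, Prod.mk.injEq, true_and] at *
    ext v
    simp only [Finset.mem_inter]
    constructor
    · rintro ⟨h1, h2⟩
      exact ⟨h1, (hh v (by simp [intr, h1])).2 h2⟩
    · rintro ⟨h1, h2⟩
      exact ⟨h1, (hh v (by simp [intr, h1])).1 h2⟩
  | succ n ih =>
    have e := ih (fun v hv => hh v (fun hc => hv (st_succ_sub n hc)))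
    simp only [st, stp] at *
    rw [e]
    split_ifs at * with hc
    · rfl
    · simp only [Prod.mk.injEq, true_and]
      ext v
      simp only [Finset.mem_inter]
      constructor
      · rintro ⟨⟨h1, h2⟩, h3⟩
        exact ⟨⟨h1, h2⟩, (hh v (by simp [h1])).2 h3⟩
      · rintro ⟨⟨h1, h2⟩, h3⟩
        exact ⟨⟨h1, h2⟩, (hh v (by simp [h1])).1 h3⟩

theorem st_good (t : ℝ) (ht : 0 < t) (n : ℕ) :
    (∑ v ∈ (st ν h b H n).2, pm ν (st ν h b H n).1 v ≤ h) ∨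
      Rf ν (st ν h b H n).1 + 4 * t ^ 2 * (st ν h b H n).1.card + n * (2 * t * h) ≤
        Rf ν (intr b) + 4 * t ^ 2 * (intr b).card := by
  induction n with
  | zero => right; simp [st]
  | succ n ih =>
    by_cases hc : ∑ v ∈ (st ν h b H n).2, pm ν (st ν h b H n).1 v ≤ h
    · left
      simp only [st, stp, if_pos hc]
      exact hc
    · have ih' := ih.resolve_left hc
      by_cases hc2 : ∑ v ∈ (st ν h b H (n + 1)).2, pm ν (st ν h b H (n + 1)).1 v ≤ h
      · exact Or.inl hc2
      · right
        push Not at hc2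
        have hS : (st ν h b H (n + 1)).2 ⊆ (st ν h b H n).1 := by
          simp only [st, stp, if_neg hc]
          exact Finset.inter_subset_left.trans Finset.inter_subset_right
        have e := energy_step ν _ _ _ (st_succ_sub (ν := ν) (h := h) (b := b) (H := H) n) hS t
        have hcard : (st ν h b H (n + 1)).2.card + (st ν h b H (n + 1)).1.card ≤
            (st ν h b H n).1.card := by
          rw [← Finset.card_union_of_disjoint]
          · exact Finset.card_le_card (Finset.union_subset hS (st_succ_sub n))
          · rw [Finset.disjoint_left]
            exact fun s hs => st_disj (n + 1) s hs
        have hcard' : ((st ν h b H (n + 1)).2.card : ℝ) + (st ν h b H (n + 1)).1.card ≤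
            (st ν h b H n).1.card := by exact_mod_cast hcard
        have m1 := mul_le_mul_of_nonneg_left hcard' (show (0 : ℝ) ≤ 4 * t ^ 2 by positivity)
        have m2 := mul_le_mul_of_nonneg_left hc2.le (show (0 : ℝ) ≤ 2 * t by positivity)
        push_cast
        linarith

/-- deterministic lower bound for the harmonic average -/
theorem det_lower {a : ℕ} (hab : a ≤ b) (n : ℕ) (x : ℤ × ℤ → ℝ) (lam M : ℝ) (hlam : 0 ≤ lam)
    (hM : 0 ≤ M) (hν : ∀ u, 0 ≤ ν u) (hνs : ∀ u, u ∉ intr a → ν u = 0)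
    (hν1 : ∑ u ∈ box b, ν u = 1)
    (hH : ∀ v, v ∈ H ↔ v ∈ box b ∧ x v ≤ lam) (hx : ∀ v ∈ box b, -M ≤ x v)
    (hno : ∀ k ≤ n, ∀ u ∈ bdry a, ∀ v ∈ bdry b, ∀ p, ¬ IsPath (↑H) u v k p)
    (hgood : ∑ v ∈ (st ν h b H n).2, pm ν (st ν h b H n).1 v ≤ h) :
    lam - (lam + M) * h ≤ ∑ v ∈ box b, pm ν (st ν h b H n).1 v * x v := by
  set D := (st ν h b H n).1 with hD
  set S := (st ν h b H n).2 with hS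
  have hint : intr a ⊆ D := st_int hab n hno
  have hDb : D ⊆ intr b := st_sub n
  have hSb : S ⊆ box b := fun s hs => ((hH s).1 (st_SH n hs)).1
  have pt : ∀ v ∈ box b, lam * pm ν D v - (lam + M) * (if v ∈ S then pm ν D v else 0)
      ≤ pm ν D v * x v := by
    intro v hv
    have p0 := pm_nonneg hν D v
    by_cases hvS : v ∈ S
    · simp only [hvS, if_true]
      nlinarith [mul_le_mul_of_nonneg_left (hx v hv) p0]
    · simp only [hvS, if_false]
      by_cases hp : pm ν D v = 0
      · simp [hp]
      · have hvD : v ∉ D := fun hc => hp (pm_of_mem ν D v hc)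
        have hνv : ν v = 0 := hνs v (fun hc => hvD (hint hc))
        have : ∃ w ∈ nbrs v, w ∈ D := by
          by_contra hc
          push Not at hc
          exact hp (pm_eq_zero ν D v hνv fun _ => hc)
        obtain ⟨w, hw, hwD⟩ := this
        have hvH := (st_bd n v w hvD hw hwD).resolve_left hvS
        have hxl : lam < x v := by
          by_contra hc
          exact hvH ((hH v).2 ⟨hv, not_lt.1 hc⟩)
        nlinarith [mul_le_mul_of_nonneg_left hxl.le p0]
  have := Finset.sum_le_sum pt
  rw [Finset.sum_sub_distrib, ← Finset.mul_sum, ← Finset.mul_sum, pm_sum ν D b hDb hν1,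
    Finset.sum_ite_mem, Finset.inter_eq_right.2 hSb] at this
  nlinarith [mul_le_mul_of_nonneg_left hgood (show 0 ≤ lam + M by linarith)]


end explore


section gauss

variable {Ω : Type} [MeasurableSpace Ω] {P : Measure Ω} {N : ℕ} {η : ℤ × ℤ → Ω → ℝ}

theorem gauss_lin (hη : IsGFF N P η) (B : Finset (ℤ × ℤ)) (l : ℤ × ℤ → ℝ) :
    P.map (fun ω => ∑ i ∈ B, l i * η i ω) =
      gaussianReal 0 (∑ i ∈ B, ∑ j ∈ B, l i * l j * gffCov N i j).toNNReal := by
  set l' : (ℤ × ℤ) →₀ ℝ := Finsupp.onFinset B (fun i => if i ∈ B then l i else 0) (by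
    intro a ha
    by_contra h
    simp [h] at ha) with hl'
  have hs : l'.support ⊆ B := Finsupp.support_onFinset_subset
  have h1 := hη.2 l' (Set.subset_univ _)
  have hv : ∀ i ∈ B, l' i = l i := fun i hi => by simp [hl', hi]
  have e1 : ∀ F : ℤ × ℤ → ℝ, ∑ i ∈ l'.support, l' i * F i = ∑ i ∈ B, l i * F i := by
    intro F
    rw [Finset.sum_subset hs (fun i _ hi => by
      rw [Finsupp.notMem_support_iff.1 hi, zero_mul])]
    exact Finset.sum_congr rfl fun i hi => by rw [hv i hi]
  have e2 : ∑ i ∈ l'.support, ∑ j ∈ l'.support, l' i * l' j * gffCov N i j =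
      ∑ i ∈ B, ∑ j ∈ B, l i * l j * gffCov N i j := by
    simp only [mul_assoc, ← Finset.mul_sum, e1]
  rw [e2] at h1
  simp only [e1] at h1
  exact h1

theorem gauss_joint (hη : IsGFF N P η) (B : Finset (ℤ × ℤ)) :
    HasGaussianLaw (fun ω (i : B) => η i ω) P where
  isGaussian_map := by
    refine isGaussian_of_map_eq_gaussianReal fun L => ?_
    set l : ℤ × ℤ → ℝ := fun i => if h : i ∈ B then L (Pi.single ⟨i, h⟩ 1) else 0 with hl
    refine ⟨_, _, (?_ : _ = _).trans (gauss_lin hη B l)⟩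
    have hm := hη.1
    rw [Measure.map_map (by fun_prop) (by fun_prop)]
    congr 1
    ext ω
    simp only [Function.comp]
    rw [← Finset.sum_coe_sort B]
    conv_lhs => rw [show (fun i : B => η i ω) = ∑ i : B, η i ω • (Pi.single i (1 : ℝ)) by
      ext j; simp [Finset.sum_apply, Pi.single_apply]]
    rw [map_sum]
    refine Finset.sum_congr rfl fun i _ => ?_
    simp [hl, mul_comm]

theorem gauss_var (hη : IsGFF N P η) (B : Finset (ℤ × ℤ)) (l : ℤ × ℤ → ℝ) :
    Var[fun ω => ∑ i ∈ B, l i * η i ω; P] = ∑ i ∈ B, ∑ j ∈ B, l i * l j * gffCov N i j := by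
  have hm := hη.1
  have h := variance_id_map (μ := P) (X := fun ω => ∑ i ∈ B, l i * η i ω) (by fun_prop)
  rw [gauss_lin hη, variance_id_gaussianReal] at h
  rw [← h, Real.coe_toNNReal _ (quad_nonneg N B l)]

theorem gauss_law (hη : IsGFF N P η) (B : Finset (ℤ × ℤ)) (l : ℤ × ℤ → ℝ) :
    HasGaussianLaw (fun ω => ∑ i ∈ B, l i * η i ω) P where
  isGaussian_map := by rw [gauss_lin hη]; infer_instance

theorem gauss_cov (hη : IsGFF N P η) (B : Finset (ℤ × ℤ)) (l k : ℤ × ℤ → ℝ) :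
    cov[fun ω => ∑ i ∈ B, l i * η i ω, fun ω => ∑ i ∈ B, k i * η i ω; P] =
      ∑ i ∈ B, ∑ j ∈ B, l i * k j * gffCov N i j := by
  have := (gauss_law hη B l).isProbabilityMeasure
  have h := variance_add (gauss_law hη B l).memLp_two (gauss_law hη B k).memLp_two
  have e : (fun ω => ∑ i ∈ B, l i * η i ω) + (fun ω => ∑ i ∈ B, k i * η i ω) =
      fun ω => ∑ i ∈ B, (l i + k i) * η i ω := by
    ext ω
    simp [add_mul, Finset.sum_add_distrib]
  rw [e, gauss_var hη B l, gauss_var hη B k, gauss_var hη B (fun i => l i + k i)] at h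
  have e2 : ∑ i ∈ B, ∑ j ∈ B, (l i + k i) * (l j + k j) * gffCov N i j =
      ∑ i ∈ B, ∑ j ∈ B, l i * l j * gffCov N i j + ∑ i ∈ B, ∑ j ∈ B, l i * k j * gffCov N i j +
      ∑ i ∈ B, ∑ j ∈ B, k i * l j * gffCov N i j + ∑ i ∈ B, ∑ j ∈ B, k i * k j * gffCov N i j := by
    simp only [← Finset.sum_add_distrib]
    exact Finset.sum_congr rfl fun i _ => Finset.sum_congr rfl fun j _ => by ring
  have e3 : ∑ i ∈ B, ∑ j ∈ B, k i * l j * gffCov N i j =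
      ∑ i ∈ B, ∑ j ∈ B, l i * k j * gffCov N i j := by
    rw [Finset.sum_comm]
    exact Finset.sum_congr rfl fun i _ => Finset.sum_congr rfl fun j _ => by
      rw [cov_symm N i j]; ring
  rw [e2, e3] at h
  linarith

theorem gauss_indep (hη : IsGFF N P η) (B A : Finset (ℤ × ℤ)) (hA : A ⊆ B) (l : ℤ × ℤ → ℝ)
    (h0 : ∀ a ∈ A, ∑ i ∈ B, l i * gffCov N i a = 0) :
    IndepFun (fun ω (_ : Unit) => ∑ i ∈ B, l i * η i ω) (fun ω (j : A) => η j ω) P := by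
  refine HasGaussianLaw.indepFun_of_covariance_eval
    (X := fun (_ : Unit) ω => ∑ i ∈ B, l i * η i ω) (Y := fun (j : A) ω => η j ω) ?_ ?_
  · let L : (B → ℝ) →ₗ[ℝ] (Unit → ℝ) × (A → ℝ) :=
      { toFun := fun x => (fun _ => ∑ i : B, l i * x i, fun j => x ⟨j, hA j.2⟩)
        map_add' := fun x y => by
          ext
          · simp [mul_add, Finset.sum_add_distrib]
          · simp
        map_smul' := fun c x => by
          ext
          · simp only [Pi.smul_apply, smul_eq_mul, RingHom.id_apply, Prod.smul_fst, Finset.mul_sum]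
            exact Finset.sum_congr rfl fun i _ => by ring
          · simp }
    have := (gauss_joint hη B).map_fun (LinearMap.toContinuousLinearMap L)
    have e : (fun ω => (LinearMap.toContinuousLinearMap L) (fun i : B => η i ω)) =
        fun ω => (fun (_ : Unit) => ∑ i ∈ B, l i * η i ω, fun (j : A) => η j ω) := by
      ext ω j
      · simp only [LinearMap.coe_toContinuousLinearMap', L, LinearMap.coe_mk, AddHom.coe_mk]
        rw [← Finset.sum_coe_sort B]
      · simp [L]
    rwa [e] at this
  · rintro _ ⟨a, ha⟩
    have h := gauss_cov hη B l (fun i => if i = a then 1 else 0)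
    simp only [mul_ite, mul_one, mul_zero, ite_mul, zero_mul, Finset.sum_ite_eq', hA ha, if_true,
      one_mul, h0 a ha] at h
    exact h

theorem gauss_half (v : NNReal) : (1 : ENNReal) ≤ 2 * gaussianReal 0 v (Set.Ici 0) := by
  have h1 : gaussianReal 0 v (Set.Iic 0) = gaussianReal 0 v (Set.Ici 0) := by
    conv_lhs => rw [show (0 : ℝ) = -0 by simp, ← gaussianReal_map_neg (μ := 0) (v := v)]
    rw [Measure.map_apply (by fun_prop) measurableSet_Iic]
    congr 1
    ext x
    simp
  calc (1 : ENNReal) = gaussianReal 0 v Set.univ := measure_univ.symm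
    _ ≤ gaussianReal 0 v (Set.Iic 0 ∪ Set.Ici 0) := measure_mono fun x _ => le_total x 0
    _ ≤ _ := measure_union_le _ _
    _ = _ := by rw [h1, two_mul]

theorem gauss_refl (hη : IsGFF N P η) (B A : Finset (ℤ × ℤ)) (hA : A ⊆ B) (l : ℤ × ℤ → ℝ)
    (h0 : ∀ a ∈ A, ∑ i ∈ B, l i * gffCov N i a = 0) (E : Set (A → ℝ)) (hE : MeasurableSet E) :
    P ((fun ω (j : A) => η j ω) ⁻¹' E) ≤
      2 * P ({ω | 0 ≤ ∑ i ∈ B, l i * η i ω} ∩ (fun ω (j : A) => η j ω) ⁻¹' E) := by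
  have hm := hη.1
  have hi := gauss_indep hη B A hA l h0
  have hY : MeasurableSet {x : Unit → ℝ | 0 ≤ x ()} :=
    measurableSet_le measurable_const (measurable_pi_apply _)
  have h := hi.measure_inter_preimage_eq_mul _ _ hY hE
  have e : (fun ω (_ : Unit) => ∑ i ∈ B, l i * η i ω) ⁻¹' {x : Unit → ℝ | 0 ≤ x ()} =
      {ω | 0 ≤ ∑ i ∈ B, l i * η i ω} := rfl
  rw [e] at h
  rw [h, ← mul_assoc]
  have h2 : P {ω | 0 ≤ ∑ i ∈ B, l i * η i ω} =
      gaussianReal 0 (∑ i ∈ B, ∑ j ∈ B, l i * l j * gffCov N i j).toNNReal (Set.Ici 0) := by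
    rw [← gauss_lin hη, Measure.map_apply (by fun_prop) measurableSet_Ici]
    rfl
  rw [h2]
  calc _ = 1 * P ((fun ω (j : A) => η j ω) ⁻¹' E) := (one_mul _).symm
    _ ≤ _ := mul_le_mul_left (gauss_half _) _

theorem gauss_tail (hη : IsGFF N P η) (B : Finset (ℤ × ℤ)) (l : ℤ × ℤ → ℝ) (C : ℝ) (hC : 0 < C)
    (hv : ∑ i ∈ B, ∑ j ∈ B, l i * l j * gffCov N i j ≤ C) (t : ℝ) (ht : 0 ≤ t) :
    P {ω | t ≤ ∑ i ∈ B, l i * η i ω} ≤ ENNReal.ofReal (Real.exp (-t ^ 2 / (2 * C))) := by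
  have := (gauss_law hη B l).isProbabilityMeasure
  have hm := hη.1
  have hs : HasSubgaussianMGF (fun ω => ∑ i ∈ B, l i * η i ω) C.toNNReal P := by
    constructor
    · intro s
      have h1 : Integrable (fun x => Real.exp (s * x))
          (P.map (fun ω => ∑ i ∈ B, l i * η i ω)) := by
        rw [gauss_lin hη]
        exact integrable_exp_mul_gaussianReal s
      exact h1.comp_measurable (by fun_prop)
    · intro s
      rw [mgf_gaussianReal (gauss_lin hη B l), Real.coe_toNNReal _ hC.le,
        Real.coe_toNNReal _ (quad_nonneg N B l)]
      gcongr
      nlinarith [mul_le_mul_of_nonneg_right hv (sq_nonneg s)]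
  have h := hs.measure_ge_le ht
  rw [Real.coe_toNNReal _ hC.le] at h
  rw [← ofReal_measureReal]
  exact ENNReal.ofReal_le_ofReal h

end gauss


theorem meas_filter {X : Type*} [MeasurableSpace X] (f : ℤ × ℤ → X → ℝ) (hf : ∀ v, Measurable (f v))
    (B : Finset (ℤ × ℤ)) (lam : ℝ) (S : Set (Finset (ℤ × ℤ))) :
    MeasurableSet {x | B.filter (fun v => f v x ≤ lam) ∈ S} := by
  have e : {x | B.filter (fun v => f v x ≤ lam) ∈ S} =
      ⋃ H ∈ S, {x | B.filter (fun v => f v x ≤ lam) = H} := by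
    ext x; simp
  rw [e]
  refine MeasurableSet.biUnion S.to_countable fun H _ => ?_
  have e2 : {x | B.filter (fun v => f v x ≤ lam) = H} =
      ⋂ v : ℤ × ℤ, {x | (v ∈ B ∧ f v x ≤ lam) ↔ v ∈ H} := by
    ext x
    simp only [Set.mem_setOf_eq, Set.mem_iInter, Finset.ext_iff, Finset.mem_filter]
  rw [e2]
  refine MeasurableSet.iInter fun v => ?_
  have h1 : MeasurableSet {x | f v x ≤ lam} := measurableSet_le (hf v) measurable_const
  by_cases hB : v ∈ B <;> by_cases hH : v ∈ H <;> simp only [hB, hH, true_and, false_and, iff_true,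
    iff_false]
  · exact h1
  · exact h1.compl
  · simp
  · simp

section core

variable {Ω : Type} [MeasurableSpace Ω] {P : Measure Ω} {N : ℕ} {η : ℤ × ℤ → Ω → ℝ}

def Hs (η : ℤ × ℤ → Ω → ℝ) (b : ℕ) (lam : ℝ) (ω : Ω) : Finset (ℤ × ℤ) :=
  (box b).filter (fun v => η v ω ≤ lam)

theorem lin_orth (ν : ℤ × ℤ → ℝ) (D : Finset (ℤ × ℤ)) (b : ℕ) (hbN : b ≤ N) (hD : D ⊆ intr b)
    (a : ℤ × ℤ) (ha : a ∉ D) : ∑ i ∈ box b, (ν i - pm ν D i) * gffCov N i a = 0 := by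
  have h1 := en_cov N (gfun ν D)
    (fun u hu => gfun_off ν D u fun h => hu (intr_mono hbN (hD h))) a
  rw [gfun_off ν D a ha, en_comm, sbp (cov_FS N a), tsum_eq_sum (s := box b)
    (fun u hu => by rw [lap_off_box ν D b hD u hu]; simp)] at h1
  rw [← h1]
  refine Finset.sum_congr rfl fun i _ => ?_
  unfold pm
  ring

theorem piece (hη : IsGFF N P η) (ν : ℤ × ℤ → ℝ) (h : ℝ) (b n : ℕ) (hbN : b ≤ N) (lam t : ℝ)
    (D : Finset (ℤ × ℤ)) (hD : D ⊆ intr b) :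
    P {ω | (st ν h b (Hs η b lam ω) n).1 = D ∧ t ≤ ∑ v ∈ box b, pm ν D v * η v ω} ≤
      2 * P {ω | (st ν h b (Hs η b lam ω) n).1 = D ∧ t ≤ ∑ v ∈ box b, ν v * η v ω} := by
  have hDb : D ⊆ box b := fun v hv => (mem_intr.1 (hD hv)).1
  set A := box b \ D with hA
  have hAb : A ⊆ box b := Finset.sdiff_subset
  set ex : ℤ × ℤ → (A → ℝ) → ℝ := fun v x => if h : v ∈ A then x ⟨v, h⟩ else 0 with hex
  have hexm : ∀ v, Measurable (ex v) := by
    intro v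
    by_cases hv : v ∈ A
    · simp only [hex, hv, dif_pos]; exact measurable_pi_apply _
    · simp only [hex, hv, dif_neg, not_false_eq_true]; exact measurable_const
  set E : Set (A → ℝ) := {x | A.filter (fun v => ex v x ≤ lam) ∈ {H | (st ν h b H n).1 = D}} ∩
    {x | t ≤ ∑ v ∈ A, pm ν D v * ex v x} with hE
  have hEm : MeasurableSet E := by
    refine (meas_filter ex hexm A lam _).inter (measurableSet_le measurable_const ?_)
    fun_prop
  have key : {ω | (st ν h b (Hs η b lam ω) n).1 = D ∧ t ≤ ∑ v ∈ box b, pm ν D v * η v ω} =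
      (fun ω (j : A) => η j ω) ⁻¹' E := by
    ext ω
    have e1 : ∑ v ∈ A, pm ν D v * ex v (fun j : A => η j ω) = ∑ v ∈ box b, pm ν D v * η v ω := by
      rw [← Finset.sum_subset hAb]
      · exact Finset.sum_congr rfl fun v hv => by simp [hex, hv]
      · intro v hv hvA
        rw [pm_of_mem ν D v, zero_mul]
        by_contra hc
        exact hvA (Finset.mem_sdiff.2 ⟨hv, hc⟩)
    have e2 : ∀ v, v ∉ D →
        (v ∈ Hs η b lam ω ↔ v ∈ A.filter (fun v => ex v (fun j : A => η j ω) ≤ lam)) := by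
      intro v hv
      by_cases hb : v ∈ box b
      · have : v ∈ A := Finset.mem_sdiff.2 ⟨hb, hv⟩
        simp [Hs, hb, this, hex]
      · have : v ∉ A := fun h => hb (hAb h)
        simp [Hs, hb, this]
    simp only [hE, Set.mem_preimage, Set.mem_inter_iff, Set.mem_setOf_eq, e1]
    refine and_congr_left fun _ => ⟨fun hh => ?_, fun hh => ?_⟩
    · rw [st_loc (H := Hs η b lam ω) _ n (by rw [hh]; exact e2)]; exact hh
    · rw [st_loc (H := A.filter (fun v => ex v (fun j : A => η j ω) ≤ lam)) _ n
        (by rw [hh]; exact fun v hv => (e2 v hv).symm)]; exact hh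
  rw [key]
  refine (gauss_refl hη (box b) A hAb (fun v => ν v - pm ν D v)
    (fun a ha => lin_orth ν D b hbN hD a (Finset.mem_sdiff.1 ha).2) E hEm).trans ?_
  gcongr
  rw [← key]
  rintro ω ⟨h1, h2, h3⟩
  refine ⟨h2, h3.trans ?_⟩
  simp only [Set.mem_setOf_eq, sub_mul, Finset.sum_sub_distrib] at h1
  linarith

theorem core_bound (hη : IsGFF N P η) (ν : ℤ × ℤ → ℝ) (h : ℝ) (a b n : ℕ) (hab : a ≤ b)
    (hbN : b ≤ N) (lam M : ℝ) (hlam : 0 ≤ lam) (hM : 0 ≤ M) (hν : ∀ u, 0 ≤ ν u)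
    (hνs : ∀ u, u ∉ intr a → ν u = 0) (hν1 : ∑ u ∈ box b, ν u = 1)
    (hgood : ∀ H, ∑ v ∈ (st ν h b H n).2, pm ν (st ν h b H n).1 v ≤ h) :
    P {ω | (∀ v ∈ box b, -M ≤ η v ω) ∧
        ∀ k ≤ n, ∀ u ∈ bdry a, ∀ v ∈ bdry b, ∀ p, ¬ IsPath (↑(Hs η b lam ω)) u v k p} ≤
      2 * P {ω | lam - (lam + M) * h ≤ ∑ v ∈ box b, ν v * η v ω} := by
  set t := lam - (lam + M) * h with ht
  have hm := hη.1
  calc _ ≤ P (⋃ D ∈ (intr b).powerset,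
        {ω | (st ν h b (Hs η b lam ω) n).1 = D ∧ t ≤ ∑ v ∈ box b, pm ν D v * η v ω}) := by
        refine measure_mono ?_
        rintro ω ⟨h1, h2⟩
        simp only [Set.mem_iUnion]
        refine ⟨(st ν h b (Hs η b lam ω) n).1, Finset.mem_powerset.2 (st_sub n), rfl, ?_⟩
        exact det_lower hab n (fun v => η v ω) lam M hlam hM hν hνs hν1
          (fun v => by simp [Hs]) h1 h2 (hgood _)
    _ ≤ ∑ D ∈ (intr b).powerset, P
        {ω | (st ν h b (Hs η b lam ω) n).1 = D ∧ t ≤ ∑ v ∈ box b, pm ν D v * η v ω} :=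
        measure_biUnion_finset_le _ _
    _ ≤ ∑ D ∈ (intr b).powerset, 2 * P
        {ω | (st ν h b (Hs η b lam ω) n).1 = D ∧ t ≤ ∑ v ∈ box b, ν v * η v ω} :=
        Finset.sum_le_sum fun D hD => piece hη ν h b n hbN lam t D (Finset.mem_powerset.1 hD)
    _ = 2 * P (⋃ D ∈ (intr b).powerset,
        {ω | (st ν h b (Hs η b lam ω) n).1 = D ∧ t ≤ ∑ v ∈ box b, ν v * η v ω}) := by
        rw [← Finset.mul_sum, measure_biUnion_finset]
        · intro D _ D' _ hne
          refine Set.disjoint_left.2 fun ω h1 h2 => hne ?_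
          exact h1.1.symm.trans h2.1
        · intro D _
          have h2 : MeasurableSet {ω | t ≤ ∑ v ∈ box b, ν v * η v ω} :=
            measurableSet_le measurable_const (by fun_prop)
          exact (meas_filter η hm (box b) lam {H | (st ν h b H n).1 = D}).inter h2
    _ ≤ _ := by
        gcongr
        exact Set.iUnion₂_subset fun D _ ω hω => hω.2

theorem low_bound (hη : IsGFF N P η) (hN : 1 ≤ N) (b : ℕ) (hb : (box b).card ≤ N ^ 2) :
    P {ω | ¬ ∀ v ∈ box b, -(10 * (1 + Real.log N)) ≤ η v ω} ≤
      ENNReal.ofReal ((N : ℝ) ^ (-(20 : ℝ))) := by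
  have hN' : (0 : ℝ) < N := by exact_mod_cast hN
  have hL : 0 ≤ Real.log N := Real.log_nonneg (by exact_mod_cast hN)
  set L := Real.log N with hLd
  have h1 : ∀ v ∈ box b, P {ω | 10 * (1 + L) ≤ ∑ i ∈ {v}, (-1 : ℝ) * η i ω} ≤
      ENNReal.ofReal (Real.exp (-25 * (1 + L))) := by
    intro v _
    refine (gauss_tail hη {v} (fun _ => -1) (2 * (1 + L)) (by positivity) ?_ (10 * (1 + L))
      (by positivity)).trans_eq ?_
    · simpa using cov_diag_le N hN v
    · congr 2
      field_simp
      ring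
  calc _ ≤ P (⋃ v ∈ box b, {ω | 10 * (1 + L) ≤ ∑ i ∈ {v}, (-1 : ℝ) * η i ω}) := by
        refine measure_mono fun ω hω => ?_
        simp only [Set.mem_setOf_eq, not_forall, not_le] at hω
        obtain ⟨v, hv, h2⟩ := hω
        simp only [Set.mem_iUnion]
        refine ⟨v, hv, ?_⟩
        simp only [Finset.sum_singleton, Set.mem_setOf_eq]
        linarith
    _ ≤ ∑ v ∈ box b, P {ω | 10 * (1 + L) ≤ ∑ i ∈ {v}, (-1 : ℝ) * η i ω} :=
        measure_biUnion_finset_le _ _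
    _ ≤ ∑ v ∈ box b, ENNReal.ofReal (Real.exp (-25 * (1 + L))) := Finset.sum_le_sum h1
    _ = ENNReal.ofReal ((box b).card * Real.exp (-25 * (1 + L))) := by
        rw [Finset.sum_const, nsmul_eq_mul, ENNReal.ofReal_mul (by positivity),
          ENNReal.ofReal_natCast]
    _ ≤ _ := by
        refine ENNReal.ofReal_le_ofReal ?_
        have h3 : ((box b).card : ℝ) ≤ Real.exp (2 * L) := by
          rw [two_mul, Real.exp_add, hLd, Real.exp_log hN', ← sq]
          exact_mod_cast hb
        rw [Real.rpow_def_of_pos hN', ← hLd]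
        calc _ ≤ Real.exp (2 * L) * Real.exp (-25 * (1 + L)) := by gcongr
          _ ≤ _ := by
            rw [← Real.exp_add]
            gcongr
            linarith

end core

theorem box_card (N : ℕ) (hN : 1 ≤ N) : (box N).card = N ^ 2 := by
  rw [box, Finset.card_product, Int.card_Icc, sq]
  congr 1 <;> omega

def sg (m : ℕ) (u : ℤ × ℤ) : ℝ := if u.1 = 0 ∧ 0 ≤ u.2 ∧ u.2 < m then (m : ℝ)⁻¹ else 0

theorem sg_sum (m : ℕ) (S : Finset (ℤ × ℤ)) (hS : ∀ j < m, ((0 : ℤ), (j : ℤ)) ∈ S)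
    (f : ℤ × ℤ → ℝ) :
    ∑ i ∈ S, sg m i * f i = (m : ℝ)⁻¹ * ∑ j ∈ Finset.range m, f (0, (j : ℤ)) := by
  have hinj : Set.InjOn (fun j : ℕ => ((0 : ℤ), (j : ℤ))) (Finset.range m) := by
    intro i _ j _ h
    simpa using h
  have hsub : (Finset.range m).image (fun j : ℕ => ((0 : ℤ), (j : ℤ))) ⊆ S := by
    intro u hu
    obtain ⟨j, hj, rfl⟩ := Finset.mem_image.1 hu
    exact hS j (Finset.mem_range.1 hj)
  rw [← Finset.sum_subset hsub, Finset.sum_image hinj, Finset.mul_sum]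
  · refine Finset.sum_congr rfl fun j hj => ?_
    have := Finset.mem_range.1 hj
    simp [sg, this]
  · rintro ⟨x, y⟩ _ hu
    rw [sg, if_neg, zero_mul]
    rintro ⟨h1, h2, h3⟩
    refine hu (Finset.mem_image.2 ⟨y.toNat, Finset.mem_range.2 (by simp only at h2 h3; omega), ?_⟩)
    simp only at h1 h2
    rw [h1, Int.toNat_of_nonneg h2]

theorem seg_intr (a j : ℕ) (ha : 3 ≤ a) (hj : j < a / 2) : ((0 : ℤ), (j : ℤ)) ∈ intr a := by
  rw [mem_intr]
  refine ⟨mem_box.2 ⟨by constructor <;> simp only <;> omega, by constructor <;> simp only <;> omega⟩,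
    fun w hw => ?_⟩
  simp only [nbrs, Finset.mem_insert, Finset.mem_singleton] at hw
  rw [mem_box]
  rcases hw with rfl | rfl | rfl | rfl <;>
    refine ⟨⟨?_, ?_⟩, ⟨?_, ?_⟩⟩ <;> simp only <;> omega

theorem seg_bound (N a m : ℕ) (ha : 3 ≤ a) (hm : m = a / 2) (haN : a ≤ N) (S : Finset (ℤ × ℤ))
    (hS : intr a ⊆ S) (f : ℤ × ℤ → ℝ) (hf : ∀ u, u ∉ intr N → f u = 0) :
    (∑ i ∈ S, sg m i * f i) ^ 2 ≤ (N / m : ℝ) * en f f := by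
  rw [sg_sum m S (fun j hj => hS (seg_intr a j ha (hm ▸ hj)))]
  refine seg_ineq ⟨intr N, hf⟩ N m (by omega) fun j hj => hf _ fun hc => ?_
  have := (mem_box.1 (mem_intr.1 hc).1).1.2
  simp only at this
  omega

theorem good_all (N a b m n : ℕ) (ha : 3 ≤ a) (hm : m = a / 2) (hab : a ≤ b) (hbN : b ≤ N)
    (C h : ℝ) (hC : (N / m : ℝ) ≤ C) (hn : N * (C + 4) < n * (2 * h)) (H : Finset (ℤ × ℤ)) :
    ∑ v ∈ (st (sg m) h b H n).2, pm (sg m) (st (sg m) h b H n).1 v ≤ h := by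
  have hN : 1 ≤ N := by omega
  have hN' : (0 : ℝ) < N := by exact_mod_cast hN
  refine (st_good (ν := sg m) (h := h) (b := b) (H := H) (1 / N : ℝ) (by positivity) n).resolve_right
    fun hc => ?_
  have h1 : Rf (sg m) (intr b) ≤ N / m := Rf_le _ _ _ (by positivity) fun f hf =>
    seg_bound N a m ha hm (hab.trans hbN) _ (intr_mono hab) f
      fun u hu => hf u fun h => hu (intr_mono hbN h)
  have h2 : ((intr b).card : ℝ) ≤ N ^ 2 := by
    have : (intr b).card ≤ (box N).card :=
      Finset.card_le_card fun u hu => box_mono hbN (mem_intr.1 hu).1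
    rw [box_card N hN] at this
    exact_mod_cast this
  have h3 := Rf_nonneg (sg m) (st (sg m) h b H n).1
  have h4 : 4 * (1 / N : ℝ) ^ 2 * (intr b).card ≤ 4 := by
    calc 4 * (1 / N : ℝ) ^ 2 * (intr b).card ≤ 4 * (1 / N : ℝ) ^ 2 * N ^ 2 := by gcongr
      _ = 4 := by field_simp
  have h5 : 0 ≤ 4 * (1 / N : ℝ) ^ 2 * ((st (sg m) h b H n).1.card : ℝ) := by positivity
  have h6 : (n : ℝ) * (2 * (1 / N : ℝ) * h) ≤ C + 4 := by linarith
  have h7 : (n : ℝ) * (2 * h) = N * (n * (2 * (1 / N : ℝ) * h)) := by field_simp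
  have := mul_le_mul_of_nonneg_left h6 hN'.le
  linarith

theorem main_bound {Ω : Type} [MeasurableSpace Ω] {P : Measure Ω} {N : ℕ} {η : ℤ × ℤ → Ω → ℝ}
    (hη : IsGFF N P η) (a b n : ℕ) (ha : 3 ≤ a) (hab : a ≤ b) (hbN : b ≤ N) (C T lam : ℝ)
    (hC : (N / (a / 2 : ℕ) : ℝ) ≤ C) (hn : 20 * (1 + Real.log N) * (C + 4) * N < n) (hnT : (n : ℝ) < T)
    (hlam : 1 ≤ lam) :
    P {ω | DistGe {v : ℤ × ℤ | v ∈ box N ∧ η v ω ≤ lam} (↑(bdry a)) (↑(bdry b)) T} ≤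
      ENNReal.ofReal (2 * Real.exp (-(lam / 4) ^ 2 / (2 * C)) + (N : ℝ) ^ (-(20 : ℝ))) := by
  have hN : 1 ≤ N := by omega
  have hN' : (0 : ℝ) < N := by exact_mod_cast hN
  have hL : 0 ≤ Real.log N := Real.log_nonneg (by exact_mod_cast hN)
  obtain ⟨m, hm⟩ : ∃ m, m = a / 2 := ⟨_, rfl⟩
  rw [← hm] at hC
  have hm0 : (0 : ℝ) < m := by exact_mod_cast (show 0 < m by omega)
  have hC0 : 0 < C := lt_of_lt_of_le (by positivity) hC
  set M := 10 * (1 + Real.log N) with hM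
  have hM1 : 1 ≤ M := by rw [hM]; linarith
  set h : ℝ := 1 / (4 * M) with hh
  have hsum : ∑ u ∈ box b, sg m u = 1 := by
    have := sg_sum m (box b) (fun j hj => (mem_intr.1 (intr_mono hab (seg_intr a j ha (hm ▸ hj)))).1)
      (fun _ => 1)
    simp only [mul_one, Finset.sum_const, Finset.card_range, nsmul_eq_mul] at this
    rw [this]
    field_simp
  have hbox : (box b).card ≤ N ^ 2 := by
    rw [← box_card N hN]
    exact Finset.card_le_card (box_mono hbN)
  have hcore := core_bound hη (sg m) h a b n hab hbN lam M (by linarith) (by linarith)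
    (fun u => by unfold sg; split_ifs <;> positivity)
    (fun u hu => by
      rw [sg, if_neg]
      rintro ⟨h1, h2, h3⟩
      apply hu
      have := seg_intr a u.2.toNat ha (by omega)
      rwa [Int.toNat_of_nonneg h2, ← h1] at this)
    hsum
    (good_all N a b m n ha hm hab hbN C h hC (by
      rw [hh]
      have : (n : ℝ) * (2 * (1 / (4 * M))) = n / (2 * M) := by field_simp; norm_num
      rw [this, lt_div_iff₀ (by linarith)]
      rw [hM]
      linarith))
  have ht : lam / 4 ≤ lam - (lam + M) * h := by
    have : (lam + M) * h = lam / M / 4 + 1 / 4 := by rw [hh]; field_simp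
    have h2 : lam / M ≤ lam := div_le_self (by linarith) hM1
    rw [this]
    linarith
  have htail : P {ω | lam - (lam + M) * h ≤ ∑ v ∈ box b, sg m v * η v ω} ≤
      ENNReal.ofReal (Real.exp (-(lam / 4) ^ 2 / (2 * C))) := by
    refine (measure_mono ?_).trans (gauss_tail hη (box b) (sg m) C hC0 ?_ (lam / 4) (by linarith))
    · intro ω hω
      exact ht.trans hω
    · exact (quad_le N (box b) (sg m) (N / m) (by positivity) fun f hf =>
        seg_bound N a m ha hm (hab.trans hbN) _
          (fun u hu => (mem_intr.1 (intr_mono hab hu)).1) f hf).trans hC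
  rw [ENNReal.ofReal_add (by positivity) (by positivity), ENNReal.ofReal_mul (by norm_num)]
  refine (measure_mono (?_ : _ ⊆ {ω | (∀ v ∈ box b, -M ≤ η v ω) ∧
        ∀ k ≤ n, ∀ u ∈ bdry a, ∀ v ∈ bdry b, ∀ p, ¬ IsPath (↑(Hs η b lam ω)) u v k p} ∪
      {ω | ¬ ∀ v ∈ box b, -M ≤ η v ω})).trans ((measure_union_le _ _).trans (add_le_add
        (hcore.trans ?_) (low_bound hη hN b hbox)))
  · intro ω hω
    by_cases hc : ∀ v ∈ box b, -M ≤ η v ω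
    · left
      refine ⟨hc, fun k hk u hu v hv p hp => ?_⟩
      have h1 := hω k u (by simpa using hu) v (by simpa using hv) p
        ⟨hp.1, hp.2.1, fun i hi => by
          have := hp.2.2.1 i hi
          simp only [Hs, Finset.coe_filter, Set.mem_setOf_eq] at this
          exact ⟨box_mono hbN this.1, this.2⟩, hp.2.2.2⟩
      have h2 : (k : ℝ) ≤ n := by exact_mod_cast hk
      linarith
    · right
      exact hc
  · rw [ENNReal.ofReal_ofNat]
    gcongr

theorem eventually_exp (χ K : ℝ) (hχ : 0 < χ) (hK : 0 < K) :
    ∃ N0 : ℕ, ∀ N ≥ N0, K * (1 + Real.log N) < Real.exp ((Real.log N) ^ χ) := by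
  have h1 : Filter.Tendsto (fun N : ℕ => Real.log N) Filter.atTop Filter.atTop :=
    Real.tendsto_log_atTop.comp tendsto_natCast_atTop_atTop
  have h2 := (tendsto_exp_mul_div_rpow_atTop (1 / χ) 1 one_pos).comp
    ((tendsto_rpow_atTop hχ).comp h1)
  have h3 := (h2.eventually_gt_atTop (2 * K)).and (h1.eventually_ge_atTop 1)
  obtain ⟨N0, h⟩ := Filter.eventually_atTop.1 h3
  refine ⟨N0, fun N hN => ?_⟩
  obtain ⟨h4, h5⟩ := h N hN
  simp only [Function.comp, one_mul] at h4
  rw [← Real.rpow_mul (by linarith), mul_one_div_cancel hχ.ne', Real.rpow_one,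
    lt_div_iff₀ (by linarith)] at h4
  nlinarith

/-- For any `0 < α < β < 1` and `χ > 1/2`, there exist constants `c > 0`
and `λ₀ > 0` such that for all `λ ≥ λ₀` and all `N ≥ 1`,
`ℙ(D_{N,λ}(∂V_{αN}, ∂V_{βN}) ≥ N e^{(log N)^χ}) ≤ c⁻¹ (e^{-cλ²} + N^{-20})`. -/
theorem stmt0 (α β χ : ℝ) (hα : 0 < α) (hαβ : α < β) (hβ : β < 1) (hχ : 1 / 2 < χ) :
    ∃ c > (0 : ℝ), ∃ lam₀ > (0 : ℝ), ∀ lam : ℝ, lam₀ ≤ lam → ∀ N : ℕ, 1 ≤ N →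
      ∀ (Ω : Type) (_ : MeasurableSpace Ω) (P : Measure Ω), IsProbabilityMeasure P →
        ∀ η : ℤ × ℤ → Ω → ℝ, IsGFF N P η →
          P {ω | DistGe {v : ℤ × ℤ | v ∈ box N ∧ η v ω ≤ lam}
                (↑(bdryR (α * N))) (↑(bdryR (β * N)))
                ((N : ℝ) * Real.exp ((Real.log N) ^ χ))}
            ≤ ENNReal.ofReal (c⁻¹ * (Real.exp (-c * lam ^ 2) + (N : ℝ) ^ (-(20 : ℝ)))) := by
  set C : ℝ := 4 / α with hC
  have hC0 : 0 < C := by positivity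
  set K : ℝ := 20 * (C + 4) + 1 with hK
  obtain ⟨N1, hN1⟩ := eventually_exp χ K (by linarith) (by positivity)
  obtain ⟨N2, hN2⟩ := exists_nat_ge (4 / α)
  set N0 := N1 + N2 + 1 with hN0
  have hN0p : (1 : ℝ) ≤ N0 := by rw [hN0]; push_cast; linarith [Nat.cast_nonneg (α := ℝ) N1, Nat.cast_nonneg (α := ℝ) N2]
  set c : ℝ := min (min (1 / 2) (α / 128)) (((N0 : ℝ) ^ (20 : ℝ))⁻¹) with hc
  have hc0 : 0 < c := by
    refine lt_min (lt_min (by norm_num) (by positivity)) (by positivity)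
  have hc1 : c ≤ 1 / 2 := (min_le_left _ _).trans (min_le_left _ _)
  have hc2 : c ≤ α / 128 := (min_le_left _ _).trans (min_le_right _ _)
  have hc3 : c ≤ ((N0 : ℝ) ^ (20 : ℝ))⁻¹ := min_le_right _ _
  refine ⟨c, hc0, 1, one_pos, fun lam hlam N hN Ω _ P hP η hη => ?_⟩
  have hNp : (0 : ℝ) < N := by exact_mod_cast hN
  have hL : 0 ≤ Real.log N := Real.log_nonneg (by exact_mod_cast hN)
  by_cases hNN : N < N0
  · refine prob_le_one.trans ?_
    rw [← ENNReal.ofReal_one]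
    refine ENNReal.ofReal_le_ofReal ?_
    have h1 : (N0 : ℝ) ^ (20 : ℝ) ≤ c⁻¹ := by
      rw [le_inv_comm₀ (by positivity) hc0]; exact hc3
    have h2 : (N : ℝ) ^ (20 : ℝ) ≤ (N0 : ℝ) ^ (20 : ℝ) := by
      gcongr
    calc (1 : ℝ) = (N : ℝ) ^ (20 : ℝ) * (N : ℝ) ^ (-(20 : ℝ)) := by
          rw [← Real.rpow_add hNp]; simp
      _ ≤ c⁻¹ * (N : ℝ) ^ (-(20 : ℝ)) := by gcongr; exact h2.trans h1
      _ ≤ _ := by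
        gcongr
        linarith [Real.exp_pos (-c * lam ^ 2)]
  · push Not at hNN
    have hαN : 4 ≤ α * N := by
      have : (N2 : ℝ) ≤ N := by exact_mod_cast (show N2 ≤ N by omega)
      have h2 := hN2.trans this
      rwa [div_le_iff₀ hα, mul_comm] at h2
    set a := ⌊α * N⌋₊ with ha
    set b := ⌊β * N⌋₊ with hb
    have ha3 : 4 ≤ a := Nat.le_floor (by exact_mod_cast hαN)
    have hab : a ≤ b := Nat.floor_mono (by gcongr)
    have hbN : b ≤ N := by
      have : (b : ℝ) ≤ β * N := Nat.floor_le (by nlinarith)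
      have h2 : (b : ℝ) ≤ N := by nlinarith
      exact_mod_cast h2
    have hCm : (N / (a / 2 : ℕ) : ℝ) ≤ C := by
      have h1 : α * N < a + 1 := Nat.lt_floor_add_one _
      have h2 : a + 1 ≤ 2 * (a / 2) + 2 := by omega
      have h3 : ((a : ℝ) + 1) ≤ 2 * ((a / 2 : ℕ) : ℝ) + 2 := by exact_mod_cast h2
      have h4 : (0 : ℝ) < ((a / 2 : ℕ) : ℝ) := by exact_mod_cast (show 0 < a / 2 by omega)
      rw [hC, div_le_div_iff₀ h4 hα]
      linarith
    set n := ⌊20 * (1 + Real.log N) * (C + 4) * N⌋₊ + 1 with hn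
    have hn1 : 20 * (1 + Real.log N) * (C + 4) * N < n := by
      rw [hn]; push_cast; exact Nat.lt_floor_add_one _
    have hn2 : (n : ℝ) < (N : ℝ) * Real.exp ((Real.log N) ^ χ) := by
      have h1 : (n : ℝ) ≤ 20 * (1 + Real.log N) * (C + 4) * N + 1 := by
        rw [hn]; push_cast
        gcongr
        exact Nat.floor_le (by positivity)
      have h2 := hN1 N (by omega)
      have h3 : (1 : ℝ) ≤ N := by exact_mod_cast hN
      have h4 := mul_lt_mul_of_pos_left h2 hNp
      have h5 : (1 : ℝ) ≤ N * (1 + Real.log N) := by nlinarith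
      have h6 : (N : ℝ) * (K * (1 + Real.log N)) =
        20 * (1 + Real.log N) * (C + 4) * N + N * (1 + Real.log N) := by rw [hK]; ring
      linarith
    refine (main_bound hη a b n (by omega) hab hbN C _ lam hCm hn1 hn2 hlam).trans ?_
    refine ENNReal.ofReal_le_ofReal ?_
    have h2 : (2 : ℝ) ≤ c⁻¹ := by
      rw [le_inv_comm₀ (by norm_num) hc0]; linarith
    have h3 : Real.exp (-(lam / 4) ^ 2 / (2 * C)) ≤ Real.exp (-c * lam ^ 2) := by
      gcongr
      have : -(lam / 4) ^ 2 / (2 * C) = -(α / 128) * lam ^ 2 := by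
        rw [hC]; field_simp; norm_num
      rw [this]
      nlinarith [mul_le_mul_of_nonneg_right hc2 (sq_nonneg lam)]
    have h4 : 0 < (N : ℝ) ^ (-(20 : ℝ)) := by positivity
    have h5 := Real.exp_pos (-c * lam ^ 2)
    nlinarith

end
end

section
/- For any fixed 0 < r < 1, there exists a constant c₁ > 0 depending on r such that for all N ≥ 1 and all u ∈ ∂V_{rN}, Σ_{v ∈ ∂V_{rN}} G_{V_N}(u,v) ≤ c₁ N. -/
open MeasureTheory ProbabilityTheory Set

attribute [local instance] Classical.propDecidable

noncomputable section

theorem sum_nbrs_aux (h : ℤ × ℤ → ℝ) (u : ℤ × ℤ) :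
    ∑ w ∈ nbrs u, h w = h (u.1 + 1, u.2) + h (u.1 - 1, u.2) + h (u.1, u.2 + 1) +
      h (u.1, u.2 - 1) := by
  unfold nbrs
  rw [Finset.sum_insert, Finset.sum_insert, Finset.sum_insert, Finset.sum_singleton]
  · ring
  · simp only [Finset.mem_singleton, Prod.mk.injEq]; omega
  · simp only [Finset.mem_insert, Finset.mem_singleton, Prod.mk.injEq]; omega
  · simp only [Finset.mem_insert, Finset.mem_singleton, Prod.mk.injEq]; omega

theorem killedStep_nonneg_aux (K : Set (ℤ × ℤ)) (n : ℕ) :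
    ∀ u v, 0 ≤ killedStep K n u v := by
  induction n with
  | zero => intro u v; unfold killedStep; split_ifs <;> norm_num
  | succ n ih =>
    intro u v; unfold killedStep
    split_ifs
    · exact le_rfl
    · exact mul_nonneg (by norm_num) (Finset.sum_nonneg fun w _ => ih w v)

theorem super_aux (D : Finset (ℤ × ℤ)) (K : Set (ℤ × ℤ)) (B : Finset (ℤ × ℤ)) (f : ℤ × ℤ → ℝ)
    (hD : ∀ u ∈ D, u ∉ K → ∀ w ∈ nbrs u, w ∈ D) (hf : ∀ u ∈ D, 0 ≤ f u)
    (hs : ∀ u ∈ D, (if u ∈ B then 1 else 0) + (1 / 4) * ∑ w ∈ nbrs u, f w ≤ f u) (n : ℕ) :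
    ∀ u ∈ D, ∑ k ∈ Finset.range n, ∑ v ∈ B, killedStep K k u v ≤ f u := by
  induction n with
  | zero => intro u hu; simpa using hf u hu
  | succ n ih =>
    intro u hu
    by_cases hK : u ∈ K
    · refine le_trans (le_of_eq ?_) (hf u hu)
      refine Finset.sum_eq_zero fun k _ => Finset.sum_eq_zero fun v _ => ?_
      cases k <;> simp [killedStep, hK]
    · refine le_trans ?_ (hs u hu)
      rw [Finset.sum_range_succ']
      have h0 : ∑ v ∈ B, killedStep K 0 u v = if u ∈ B then 1 else 0 := by
        simp [killedStep, hK]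
      have h1 : ∑ k ∈ Finset.range n, ∑ v ∈ B, killedStep K (k + 1) u v =
          (1 / 4) * ∑ w ∈ nbrs u, ∑ k ∈ Finset.range n, ∑ v ∈ B, killedStep K k w v := by
        simp only [killedStep, hK, if_false, ← Finset.mul_sum]
        congr 1
        rw [Finset.sum_comm (s := nbrs u)]
        exact Finset.sum_congr rfl fun k _ => Finset.sum_comm
      rw [h0, h1, add_comm]
      have := Finset.sum_le_sum fun w hw => ih w (hD u hu hK w hw)
      linarith

theorem green_aux (D : Finset (ℤ × ℤ)) (K : Set (ℤ × ℤ)) (B : Finset (ℤ × ℤ)) (f : ℤ × ℤ → ℝ)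
    (hD : ∀ u ∈ D, u ∉ K → ∀ w ∈ nbrs u, w ∈ D) (hf : ∀ u ∈ D, 0 ≤ f u)
    (hs : ∀ u ∈ D, (if u ∈ B then 1 else 0) + (1 / 4) * ∑ w ∈ nbrs u, f w ≤ f u)
    (u : ℤ × ℤ) (hu : u ∈ D) : ∑ v ∈ B, greenK K u v ≤ f u := by
  have key := fun n => super_aux D K B f hD hf hs n u hu
  unfold greenK
  rw [← Summable.tsum_finsetSum]
  · exact Real.tsum_le_of_sum_range_le
      (fun n => Finset.sum_nonneg fun v _ => killedStep_nonneg_aux K n u v) key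
  · intro v hv
    refine summable_of_sum_range_le (fun n => killedStep_nonneg_aux K n u v)
      (fun n => le_trans (Finset.sum_le_sum fun k _ => ?_) (key n))
    exact Finset.single_le_sum (f := fun v => killedStep K k u v)
      (fun v _ => killedStep_nonneg_aux K k u v) hv

theorem abs_aux (t a : ℤ) : 2 * |t - a| + (if t = a then 2 else 0) ≤ |t + 1 - a| + |t - 1 - a| := by
  split_ifs <;> grind

def potF (N : ℕ) (a b : ℤ) (u : ℤ × ℤ) : ℤ :=
  8 * N - 2 * (|u.1 - a| + |u.1 - b| + |u.2 - a| + |u.2 - b|)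

theorem potF_aux (N : ℕ) (a b : ℤ) (u : ℤ × ℤ)
    (h : u.1 = a ∨ u.1 = b ∨ u.2 = a ∨ u.2 = b) :
    4 + (potF N a b (u.1 + 1, u.2) + potF N a b (u.1 - 1, u.2) + potF N a b (u.1, u.2 + 1) +
      potF N a b (u.1, u.2 - 1)) ≤ 4 * potF N a b u := by
  have h1 := abs_aux u.1 a
  have h2 := abs_aux u.1 b
  have h3 := abs_aux u.2 a
  have h4 := abs_aux u.2 b
  simp only [potF]
  rcases h with h | h | h | h <;> split_ifs at h1 h2 h3 h4 <;> first | contradiction | linarith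

theorem potF_aux0 (N : ℕ) (a b : ℤ) (u : ℤ × ℤ) :
    (potF N a b (u.1 + 1, u.2) + potF N a b (u.1 - 1, u.2) + potF N a b (u.1, u.2 + 1) +
      potF N a b (u.1, u.2 - 1)) ≤ 4 * potF N a b u := by
  have h1 := abs_aux u.1 a
  have h2 := abs_aux u.1 b
  have h3 := abs_aux u.2 a
  have h4 := abs_aux u.2 b
  simp only [potF]
  split_ifs at h1 h2 h3 h4 <;> linarith

theorem bdry_aux (M : ℕ) (v : ℤ × ℤ) (hv : v ∈ bdry M) :
    v ∈ box M ∧ (v.1 = -(((M : ℤ) - 1) / 2) ∨ v.1 = (M : ℤ) / 2 ∨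
      v.2 = -(((M : ℤ) - 1) / 2) ∨ v.2 = (M : ℤ) / 2) := by
  unfold bdry at hv
  rw [Finset.mem_filter] at hv
  obtain ⟨hb, w, hw, hn⟩ := hv
  refine ⟨hb, ?_⟩
  simp only [box, Finset.mem_product, Finset.mem_Icc] at hb hn
  simp only [nbrs, Finset.mem_insert, Finset.mem_singleton] at hw
  rcases hw with rfl | rfl | rfl | rfl <;> simp only at hn <;> omega

theorem main_aux (N M : ℕ) (hMN : M ≤ N) (u : ℤ × ℤ) (hu : u ∈ bdry M) :
    ∑ v ∈ bdry M, green N u v ≤ 8 * N := by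
  set a : ℤ := -(((M : ℤ) - 1) / 2) with ha
  set b : ℤ := (M : ℤ) / 2 with hb
  have hub := (bdry_aux M u hu).1
  have hne : 1 ≤ M := by
    simp only [box, Finset.mem_product, Finset.mem_Icc] at hub; omega
  have huN : u ∈ box N := by
    simp only [box, Finset.mem_product, Finset.mem_Icc] at hub ⊢; omega
  have hle : (potF N a b u : ℝ) ≤ 8 * N := by
    have : potF N a b u ≤ 8 * N := by unfold potF; have := abs_nonneg (u.1 - a)
                                      have := abs_nonneg (u.1 - b)
                                      have := abs_nonneg (u.2 - a)
                                      have := abs_nonneg (u.2 - b)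
                                      linarith
    exact_mod_cast this
  refine le_trans (green_aux (box N) (↑(bdry N)) (bdry M) (fun w => (potF N a b w : ℝ))
    ?_ ?_ ?_ u huN) hle
  · intro x hx hxK w hw
    by_contra hc
    exact hxK (by simp only [bdry, Finset.coe_filter, Set.mem_setOf_eq]; exact ⟨hx, w, hw, hc⟩)
  · intro x hx
    simp only [box, Finset.mem_product, Finset.mem_Icc] at hx
    have : 0 ≤ potF N a b x := by
      have h1 : |x.1 - a| ≤ N := abs_le.2 (by omega)
      have h2 : |x.1 - b| ≤ N := abs_le.2 (by omega)
      have h3 : |x.2 - a| ≤ N := abs_le.2 (by omega)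
      have h4 : |x.2 - b| ≤ N := abs_le.2 (by omega)
      unfold potF; linarith
    exact_mod_cast this
  · intro x hx
    rw [sum_nbrs_aux]
    split_ifs with h
    · have := potF_aux N a b x (bdry_aux M x h).2
      have h' : (4 : ℝ) + (potF N a b (x.1 + 1, x.2) + potF N a b (x.1 - 1, x.2) +
        potF N a b (x.1, x.2 + 1) + potF N a b (x.1, x.2 - 1)) ≤ 4 * potF N a b x := by
        exact_mod_cast this
      linarith
    · have := potF_aux0 N a b x
      have h' : ((potF N a b (x.1 + 1, x.2) : ℝ) + potF N a b (x.1 - 1, x.2) +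
        potF N a b (x.1, x.2 + 1) + potF N a b (x.1, x.2 - 1)) ≤ 4 * potF N a b x := by
        exact_mod_cast this
      linarith

/-- For fixed `0 < r < 1` there is `c₁ > 0` (depending on `r`) with
`∑_{v ∈ ∂V_{rN}} G_{V_N}(u,v) ≤ c₁ N` for all `N ≥ 1` and all `u ∈ ∂V_{rN}`. -/
theorem stmt3 (r : ℝ) (hr0 : 0 < r) (hr1 : r < 1) :
    ∃ c₁ > (0 : ℝ), ∀ N : ℕ, 1 ≤ N → ∀ u ∈ bdryR (r * N),
      ∑ v ∈ bdryR (r * N), green N u v ≤ c₁ * N := by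
  refine ⟨8, by norm_num, fun N _ u hu => main_aux N _ ?_ u hu⟩
  refine Nat.floor_le_of_le ?_
  have : (0 : ℝ) ≤ N := Nat.cast_nonneg N
  nlinarith

end
end
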